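/- Let α, β ∈ [-1/2, 1/2], set ρ_α = α/2 + 1/4 and ρ_β = β/2 + 1/4, and for each n ≥ 1 let P_n^{(α,β),monic} be the monic Jacobi polynomial of degree n. Then for every n ≥ 1, sup_{x ∈ [-1,1]} (1-x)^{ρ_α} (1+x)^{ρ_β} |P_n^{(α,β),monic}(x)| ≤ 2^{1-n-ρ_α-ρ_β}, and for each n ≥ 1 equality holds if and only if both ρ_α ∈ {0, 1/2} and ρ_β ∈ {0, 1/2} (equivalently, α, β ∈ {-1/2, 1/2}). -/

import Mathlib

open MeasureTheory

/-- The weighted sup `sup_{x ∈ [-1,1]} (1-x)^ρα (1+x)^ρβ |P(x)|`. -/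
noncomputable def jacobiSup (ρa ρb : ℝ) (P : Polynomial ℝ) : ℝ :=
  sSup ((fun x : ℝ => (1 - x) ^ ρa * (1 + x) ^ ρb * |P.eval x|) '' Set.Icc (-1 : ℝ) 1)

/-- `P` is the monic Jacobi polynomial of degree `n` with parameters `α, β`. -/
def IsMonicJacobi (α β : ℝ) (n : ℕ) (P : Polynomial ℝ) : Prop :=
  P.Monic ∧ P.natDegree = n ∧
    ∀ k : ℕ, k < n →
      ∫ x in (-1 : ℝ)..1, (1 - x) ^ α * (1 + x) ^ β * P.eval x * x ^ k = 0

section JacobiEquation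
open Polynomial Set

/-- The Jacobi differential operator. -/
noncomputable def jacobiOp (α β : ℝ) (p : ℝ[X]) : ℝ[X] :=
  (1 - X ^ 2) * derivative (derivative p) + (C (β - α) - C (α + β + 2) * X) * derivative p

lemma coeff_jacobiOp (α β : ℝ) (p : ℝ[X]) (k : ℕ) :
    (jacobiOp α β p).coeff k = (k + 2) * (k + 1) * p.coeff (k + 2)
      + (β - α) * (k + 1) * p.coeff (k + 1) - k * (k + α + β + 1) * p.coeff k := by
  have h : jacobiOp α β p = derivative (derivative p) - X ^ 2 * derivative (derivative p)
      + (C (β - α) * derivative p - C (α + β + 2) * (X * derivative p)) := by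
    rw [jacobiOp]; ring
  rw [h]
  simp only [coeff_add, coeff_sub, coeff_C_mul]
  rcases k with _ | _ | k
  · simp [coeff_derivative]
    ring
  · simp [coeff_derivative, coeff_X_pow_mul', coeff_X_mul]
    ring
  · simp [coeff_derivative, coeff_X_pow_mul', coeff_X_mul]
    ring

lemma intervalIntegrable_jacobiWeight_mul {α β : ℝ} (hα : -1 < α) (hβ : -1 < β) {f : ℝ → ℝ}
    (hf : Continuous f) :
    IntervalIntegrable (fun x : ℝ => (1 - x) ^ α * (1 + x) ^ β * f x) volume (-1) 1 := by
  have left : IntervalIntegrable (fun x : ℝ => (1 + x) ^ β) volume (-1) 0 := by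
    have := (intervalIntegral.intervalIntegrable_rpow' (a := 0) (b := 1) hβ).comp_add_left 1
    simpa using this
  have right : IntervalIntegrable (fun x : ℝ => (1 - x) ^ α) volume 0 1 := by
    have := (intervalIntegral.intervalIntegrable_rpow' (a := 1) (b := 0) hα).comp_sub_left 1
    simpa using this
  refine IntervalIntegrable.trans (b := 0) ?_ ?_
  · have : ContinuousOn (fun x : ℝ => (1 - x) ^ α * f x) (uIcc (-1) 0) := by
      refine ContinuousOn.mul (ContinuousOn.rpow_const (by fun_prop) ?_) hf.continuousOn
      intro x hx
      rw [uIcc_of_le (by norm_num)] at hx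
      left; linarith [hx.2]
    refine (left.mul_continuousOn this).congr ?_
    intro x _; ring
  · have : ContinuousOn (fun x : ℝ => (1 + x) ^ β * f x) (uIcc 0 1) := by
      refine ContinuousOn.mul (ContinuousOn.rpow_const (by fun_prop) ?_) hf.continuousOn
      intro x hx
      rw [uIcc_of_le (by norm_num)] at hx
      left; linarith [hx.1]
    refine (right.mul_continuousOn this).congr ?_
    intro x _; ring

lemma integral_jacobiOp_symm {α β : ℝ} (hα : -1 < α) (hβ : -1 < β) (p q : ℝ[X]) :
    ∫ x in (-1 : ℝ)..1, (1 - x) ^ α * (1 + x) ^ β * ((jacobiOp α β p * q).eval x) =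
      ∫ x in (-1 : ℝ)..1, (1 - x) ^ α * (1 + x) ^ β * ((p * jacobiOp α β q).eval x) := by
  rw [← sub_eq_zero, ← intervalIntegral.integral_sub
    (intervalIntegrable_jacobiWeight_mul hα hβ (by fun_prop))
    (intervalIntegrable_jacobiWeight_mul hα hβ (by fun_prop))]
  have key := intervalIntegral.integral_eq_sub_of_hasDerivAt_of_le (a := -1) (b := 1)
    (f := fun x : ℝ => (1 - x) ^ (α + 1) * (1 + x) ^ (β + 1) *
      ((derivative p * q - p * derivative q).eval x))
    (f' := fun x : ℝ => (1 - x) ^ α * (1 + x) ^ β * ((jacobiOp α β p * q).eval x) -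
      (1 - x) ^ α * (1 + x) ^ β * ((p * jacobiOp α β q).eval x)) (by norm_num) ?_ ?_ ?_
  · rw [key]
    have h1 : (0 : ℝ) ^ (α + 1) = 0 := Real.zero_rpow (by linarith)
    have h2 : (0 : ℝ) ^ (β + 1) = 0 := Real.zero_rpow (by linarith)
    norm_num [h1, h2]
  · refine ContinuousOn.mul (ContinuousOn.mul ?_ ?_) (by fun_prop)
    · exact ContinuousOn.rpow_const (by fun_prop) fun x _ => Or.inr (by linarith)
    · exact ContinuousOn.rpow_const (by fun_prop) fun x _ => Or.inr (by linarith)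
  · intro x hx
    have hx1 : 0 < 1 - x := by linarith [hx.2]
    have hx2 : 0 < 1 + x := by linarith [hx.1]
    have d1 := ((hasDerivAt_id x).const_sub 1).rpow_const (p := α + 1) (Or.inl hx1.ne')
    have d2 := ((hasDerivAt_id x).const_add 1).rpow_const (p := β + 1) (Or.inl hx2.ne')
    have d3 := (derivative p * q - p * derivative q).hasDerivAt x
    refine ((d1.mul d2).mul d3).congr_deriv ?_
    simp only [id, Pi.mul_apply, add_sub_cancel_right]
    rw [Real.rpow_add_one hx1.ne', Real.rpow_add_one hx2.ne']
    simp only [jacobiOp, derivative_mul, derivative_sub, eval_sub, eval_add, eval_mul, eval_X,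
      eval_C, eval_pow, eval_one]
    ring
  · exact (intervalIntegrable_jacobiWeight_mul hα hβ (by fun_prop)).sub
      (intervalIntegrable_jacobiWeight_mul hα hβ (by fun_prop))

lemma eq_zero_of_integral_sq_eq_zero {α β : ℝ} (hα : -1 < α) (hβ : -1 < β) (q : ℝ[X])
    (h : ∫ x in (-1 : ℝ)..1, (1 - x) ^ α * (1 + x) ^ β * ((q * q).eval x) = 0) : q = 0 := by
  by_contra hq
  have hint := intervalIntegrable_jacobiWeight_mul hα hβ (f := fun x => (q * q).eval x)
    (by fun_prop)
  refine h.not_gt ?_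
  rw [intervalIntegral.integral_pos_iff_support_of_nonneg_ae' ?_ hint]
  · refine ⟨by norm_num, ?_⟩
    have hsub : Ioo (-1 : ℝ) 1 \ (q.roots.toFinset : Set ℝ) ⊆
        Function.support (fun x : ℝ => (1 - x) ^ α * (1 + x) ^ β * ((q * q).eval x)) ∩
          Ioc (-1) 1 := by
      rintro x ⟨hx, hxr⟩
      refine ⟨?_, hx.1, hx.2.le⟩
      have hx1 : 0 < 1 - x := by linarith [hx.2]
      have hx2 : 0 < 1 + x := by linarith [hx.1]
      have : q.eval x ≠ 0 := by
        intro h0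
        exact hxr (by simp [hq, h0])
      have h1 := (Real.rpow_pos_of_pos hx1 α).ne'
      have h2 := (Real.rpow_pos_of_pos hx2 β).ne'
      simp [h1, h2, this]
    refine lt_of_lt_of_le ?_ (measure_mono hsub)
    rw [measure_sdiff_null (Finset.measure_zero _ _)]
    simp
  · rw [uIoc_of_le (by norm_num)]
    refine (ae_restrict_iff' measurableSet_Ioc).2 (Filter.Eventually.of_forall fun x hx => ?_)
    have hx1 : 0 ≤ 1 - x := by linarith [hx.2]
    have hx2 : 0 ≤ 1 + x := by linarith [hx.1]
    simp only [eval_mul, Pi.zero_apply]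
    have := mul_self_nonneg (q.eval x)
    positivity

lemma IsMonicJacobi.integral_mul_eq_zero {α β : ℝ} (hα : -1 < α) (hβ : -1 < β) {n : ℕ}
    {P : ℝ[X]} (hP : IsMonicJacobi α β n P) {q : ℝ[X]} (hq : ∀ k, n ≤ k → q.coeff k = 0) :
    ∫ x in (-1 : ℝ)..1, (1 - x) ^ α * (1 + x) ^ β * ((P * q).eval x) = 0 := by
  have hn : q = ∑ k ∈ Finset.range n, C (q.coeff k) * X ^ k := by
    ext k
    simp only [finsetSum_coeff, coeff_C_mul_X_pow]
    by_cases hk : n ≤ k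
    · rw [hq k hk, eq_comm]
      exact Finset.sum_eq_zero fun i hi => if_neg (by have := Finset.mem_range.1 hi; omega)
    · simp [not_le.1 hk]
  have : ∀ x : ℝ, (1 - x) ^ α * (1 + x) ^ β * ((P * q).eval x) =
      ∑ k ∈ Finset.range n, q.coeff k * ((1 - x) ^ α * (1 + x) ^ β * P.eval x * x ^ k) := by
    intro x
    conv_lhs => rw [hn]
    simp only [eval_mul, eval_finsetSum, eval_C, eval_pow, eval_X, Finset.mul_sum]
    exact Finset.sum_congr rfl fun _ _ => by ring
  simp only [this]
  rw [intervalIntegral.integral_finsetSum]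
  · refine Finset.sum_eq_zero fun k hk => ?_
    rw [intervalIntegral.integral_const_mul, hP.2.2 k (Finset.mem_range.1 hk), mul_zero]
  · intro k _
    refine IntervalIntegrable.const_mul ?_ _
    refine (intervalIntegrable_jacobiWeight_mul hα hβ
      (f := fun x => P.eval x * x ^ k) (by fun_prop)).congr ?_
    intro x _; ring

theorem IsMonicJacobi.jacobiOp_eq {α β : ℝ} (hα : -1 < α) (hβ : -1 < β) {n : ℕ}
    {P : ℝ[X]} (hP : IsMonicJacobi α β n P) :
    jacobiOp α β P + C (n * (n + α + β + 1)) * P = 0 := by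
  set D := jacobiOp α β P + C (n * (n + α + β + 1)) * P with hD
  have hPc : ∀ k, n < k → P.coeff k = 0 := fun k hk =>
    coeff_eq_zero_of_natDegree_lt (hP.2.1.symm ▸ hk)
  have hDc : ∀ k, n ≤ k → D.coeff k = 0 := by
    intro k hk
    rw [hD, coeff_add, coeff_jacobiOp, coeff_C_mul, hPc (k + 2) (by omega),
      hPc (k + 1) (by omega)]
    rcases hk.eq_or_lt with rfl | hk
    · ring
    · rw [hPc k hk]; ring
  have hLc : ∀ k, n ≤ k → (jacobiOp α β D).coeff k = 0 := by
    intro k hk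
    rw [coeff_jacobiOp, hDc k hk, hDc (k + 1) (by omega), hDc (k + 2) (by omega)]
    ring
  refine eq_zero_of_integral_sq_eq_zero hα hβ D ?_
  have h1 := integral_jacobiOp_symm hα hβ P D
  rw [hP.integral_mul_eq_zero hα hβ hLc] at h1
  have h2 := hP.integral_mul_eq_zero hα hβ hDc
  have h3 : ∀ x : ℝ, (1 - x) ^ α * (1 + x) ^ β * ((D * D).eval x) =
      (1 - x) ^ α * (1 + x) ^ β * ((jacobiOp α β P * D).eval x) +
        (n * (n + α + β + 1)) * ((1 - x) ^ α * (1 + x) ^ β * ((P * D).eval x)) := by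
    intro x
    conv_lhs => rw [eval_mul]; enter [2, 1]; rw [hD]
    simp only [eval_add, eval_mul, eval_C]
    ring
  simp only [h3]
  rw [intervalIntegral.integral_add
    (intervalIntegrable_jacobiWeight_mul hα hβ (by fun_prop))
    ((intervalIntegrable_jacobiWeight_mul hα hβ (by fun_prop)).const_mul _),
    intervalIntegral.integral_const_mul, h1, h2]
  simp

end JacobiEquation

section Amplification

open Set

/-- Abstract amplification estimate for the quadratic quantities `r = |g|²`, `s = |g'|²`,
`K = Re (ḡ g')`, `J = Im (ḡ g')` of a solution of `g'' = (N² + e + i d) g`. -/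
structure IsAmplitude (N : ℝ) (e d r s K J : ℝ → ℝ) : Prop where
  r_nonneg : ∀ t, 0 ≤ t → 0 ≤ r t
  s_nonneg : ∀ t, 0 ≤ t → 0 ≤ s t
  mul_eq : ∀ t, 0 ≤ t → r t * s t = K t ^ 2 + J t ^ 2
  hasDerivAt_r : ∀ t, 0 ≤ t → HasDerivAt r (2 * K t) t
  hasDerivAt_s : ∀ t, 0 ≤ t → HasDerivAt s (2 * (N ^ 2 + e t) * K t + 2 * d t * J t) t
  hasDerivAt_K : ∀ t, 0 ≤ t → HasDerivAt K (s t + (N ^ 2 + e t) * r t) t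
  hasDerivAt_J : ∀ t, 0 ≤ t → HasDerivAt J (d t * r t) t
  K_zero : K 0 = 0

variable {N : ℝ} {e d r s K J : ℝ → ℝ}

lemma IsAmplitude.neg (h : IsAmplitude N e d r s K J) :
    IsAmplitude N e (fun t => -d t) r s K (fun t => -J t) where
  r_nonneg := h.r_nonneg
  s_nonneg := h.s_nonneg
  mul_eq t ht := by rw [h.mul_eq t ht]; ring
  hasDerivAt_r := h.hasDerivAt_r
  hasDerivAt_s t ht := (h.hasDerivAt_s t ht).congr_deriv (by ring)
  hasDerivAt_K := h.hasDerivAt_K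
  hasDerivAt_J t ht := (h.hasDerivAt_J t ht).neg.congr_deriv (by ring)
  K_zero := h.K_zero

lemma le_of_hasDerivAt_nonneg {f f' : ℝ → ℝ} {a b : ℝ} (hab : a ≤ b)
    (hf : ∀ t ∈ Icc a b, HasDerivAt f (f' t) t) (hf' : ∀ t ∈ Icc a b, 0 ≤ f' t) :
    f a ≤ f b := by
  refine monotoneOn_of_hasDerivWithinAt_nonneg (f' := f') (convex_Icc a b)
    (fun t ht => (hf t ht).continuousAt.continuousWithinAt)
    (fun t ht => (hf t (interior_subset ht)).hasDerivWithinAt)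
    (fun t ht => hf' t (interior_subset ht)) (left_mem_Icc.2 hab) (right_mem_Icc.2 hab) hab

lemma IsAmplitude.K_nonneg (h : IsAmplitude N e d r s K J) (he : ∀ t, 0 ≤ t → 0 ≤ e t)
    {t : ℝ} (ht : 0 ≤ t) : 0 ≤ K t := by
  rw [← h.K_zero]
  refine le_of_hasDerivAt_nonneg ht (fun τ hτ => h.hasDerivAt_K τ hτ.1) fun τ hτ => ?_
  have := h.r_nonneg τ hτ.1
  have := h.s_nonneg τ hτ.1
  have := he τ hτ.1
  positivity

lemma IsAmplitude.neg_le_mul_J (h : IsAmplitude N e d r s K J) (hN : 0 < N)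
    (he : ∀ t, 0 ≤ t → 0 ≤ e t) (hd : ∀ t, 0 ≤ t → 0 ≤ d t)
    (hde : ∀ t, 0 ≤ t → d t ≤ e t * Real.sinh (2 * N * t)) {t : ℝ} (ht : 0 ≤ t) :
    -(e t * K t) ≤ d t * J t := by
  have hKt := h.K_nonneg he ht
  have het := he t ht
  have hdt := hd t ht
  rcases le_or_gt 0 (J t) with hJ | hJ
  · have := mul_nonneg hdt hJ
    have := mul_nonneg het hKt
    linarith
  -- `J` increases, so `|J| ≥ |J t|` on `[0, t]`, and `K / cosh` can be bounded from below.
  suffices hK : -J t * Real.sinh (2 * N * t) ≤ K t by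
    have h1 := mul_le_mul_of_nonneg_left hK het
    have h2 := mul_le_mul_of_nonneg_right (hde t ht) (neg_pos.2 hJ).le
    linarith
  have hJm : ∀ τ ∈ Icc 0 t, J τ ≤ J t := fun τ hτ =>
    le_of_hasDerivAt_nonneg hτ.2 (fun x hx => h.hasDerivAt_J x (hτ.1.trans hx.1))
      fun x hx => mul_nonneg (hd x (hτ.1.trans hx.1)) (h.r_nonneg x (hτ.1.trans hx.1))
  have key := le_of_hasDerivAt_nonneg ht
    (f := fun τ => (K τ - -J t * Real.sinh (2 * N * τ)) / Real.cosh (2 * N * τ))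
    (fun τ hτ => by
      have hl : HasDerivAt (fun τ : ℝ => 2 * N * τ) (2 * N) τ := by
        simpa using (hasDerivAt_id τ).const_mul (2 * N)
      exact ((h.hasDerivAt_K τ hτ.1).sub (hl.sinh.const_mul (-J t))).div hl.cosh
        (Real.cosh_pos _).ne') ?_
  · simp only [mul_zero, Real.sinh_zero, Real.cosh_zero, h.K_zero, sub_zero, zero_div] at key
    have hc := Real.cosh_pos (2 * N * t)
    have := mul_nonneg key hc.le
    rw [div_mul_cancel₀ _ hc.ne'] at this
    linarith
  · intro τ hτ
    have hr := h.r_nonneg τ hτ.1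
    have hs := h.s_nonneg τ hτ.1
    have hKτ := h.K_nonneg he hτ.1
    have hm := h.mul_eq τ hτ.1
    have hJτ := hJm τ hτ
    have heτ := mul_nonneg (he τ hτ.1) hr
    have hc := Real.cosh_pos (2 * N * τ)
    have hcs := Real.cosh_sq (2 * N * τ)
    have hs0 : 0 ≤ Real.sinh (2 * N * τ) := Real.sinh_nonneg_iff.2 (by nlinarith [hτ.1])
    set c := Real.cosh (2 * N * τ)
    set σ := Real.sinh (2 * N * τ)
    have hx : 2 * N * (K τ * σ - J t) ≤ (s τ + (N ^ 2 + e τ) * r τ) * c := by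
      have h1 : 2 * N * (K τ * σ - J t) ≤ (s τ + N ^ 2 * r τ) * c := by
        refine abs_le_of_sq_le_sq' ?_ (by positivity) |>.2
        have h2 : (K τ * σ - J t) ^ 2 ≤ (K τ ^ 2 + J τ ^ 2) * c ^ 2 := by
          rw [hcs]
          have : J t ^ 2 ≤ J τ ^ 2 := by nlinarith
          nlinarith [sq_nonneg (K τ + J t * σ), mul_nonneg (sub_nonneg.2 this) (sq_nonneg σ)]
        have h3 : 4 * N ^ 2 * (r τ * s τ) ≤ (s τ + N ^ 2 * r τ) ^ 2 := by
          nlinarith [sq_nonneg (s τ - N ^ 2 * r τ)]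
        rw [hm] at h3
        calc (2 * N * (K τ * σ - J t)) ^ 2 = 4 * N ^ 2 * (K τ * σ - J t) ^ 2 := by ring
          _ ≤ 4 * N ^ 2 * ((K τ ^ 2 + J τ ^ 2) * c ^ 2) := by gcongr
          _ = 4 * N ^ 2 * (K τ ^ 2 + J τ ^ 2) * c ^ 2 := by ring
          _ ≤ (s τ + N ^ 2 * r τ) ^ 2 * c ^ 2 := by gcongr
          _ = _ := by ring
      nlinarith [mul_nonneg heτ hc.le]
    refine div_nonneg ?_ (sq_nonneg _)
    have : (K τ - -J t * σ) * (σ * (2 * N)) =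
        2 * N * (K τ * σ - J t) + 2 * N * J t * c ^ 2 := by rw [hcs]; ring
    simp only [Pi.sub_apply]
    rw [this]
    linarith

lemma IsAmplitude.hasDerivAt_energy (h : IsAmplitude N e d r s K J) {t : ℝ} (ht : 0 ≤ t) :
    HasDerivAt (fun t => (s t + 2 * N * K t + N ^ 2 * r t) * Real.exp (-(2 * N * t)))
      ((2 * e t * (K t + N * r t) + 2 * d t * J t) * Real.exp (-(2 * N * t))) t := by
  have hl : HasDerivAt (fun τ : ℝ => -(2 * N * τ)) (-(2 * N)) t := by
    simpa using ((hasDerivAt_id t).const_mul (2 * N)).fun_neg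
  refine ((((h.hasDerivAt_s t ht).add ((h.hasDerivAt_K t ht).const_mul (2 * N))).add
    ((h.hasDerivAt_r t ht).const_mul (N ^ 2))).mul hl.exp).congr_deriv ?_
  simp only [Pi.add_apply]
  ring

/-- The energy `|g' + N g|² e^{-2 N t}` increases by a definite factor. -/
lemma IsAmplitude.energy_le (h : IsAmplitude N e d r s K J) (hN : 0 < N)
    (he : ∀ t, 0 ≤ t → 0 ≤ e t) (hd : ∀ t, 0 ≤ t → 0 ≤ d t)
    (hde : ∀ t, 0 ≤ t → d t ≤ e t * Real.sinh (2 * N * t))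
    {e₀ : ℝ} (he₀ : 0 ≤ e₀) (he1 : ∀ t ∈ Icc (0 : ℝ) 1, e₀ ≤ e t) {t : ℝ} (ht : 1 ≤ t) :
    (s 0 + N ^ 2 * r 0) * (1 + 2 / 3 * N * e₀ * Real.exp (-(2 * N))) ≤
      (s t + 2 * N * K t + N ^ 2 * r t) * Real.exp (-(2 * N * t)) := by
  have hdJ := fun t ht => h.neg_le_mul_J hN he hd hde (t := t) ht
  have hK0 := fun t ht => h.K_nonneg he (t := t) ht
  have hr_mono : ∀ t, 0 ≤ t → r 0 ≤ r t := fun t ht =>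
    le_of_hasDerivAt_nonneg ht (fun τ hτ => h.hasDerivAt_r τ hτ.1)
      fun τ hτ => by linarith [hK0 τ hτ.1]
  have hs_mono : ∀ t, 0 ≤ t → s 0 ≤ s t := fun t ht =>
    le_of_hasDerivAt_nonneg ht (fun τ hτ => h.hasDerivAt_s τ hτ.1) fun τ hτ => by
      nlinarith [hdJ τ hτ.1, mul_nonneg (sq_nonneg N) (hK0 τ hτ.1)]
  set Q₀ := s 0 + N ^ 2 * r 0 with hQ₀
  have hQ₀n : 0 ≤ Q₀ := add_nonneg (h.s_nonneg 0 le_rfl)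
    (mul_nonneg (sq_nonneg N) (h.r_nonneg 0 le_rfl))
  have hKt : ∀ t, 0 ≤ t → Q₀ * t ≤ K t := fun t ht => by
    have := le_of_hasDerivAt_nonneg ht (f := fun τ => K τ - Q₀ * τ)
      (fun τ hτ => (h.hasDerivAt_K τ hτ.1).sub ((hasDerivAt_id τ).const_mul Q₀)) fun τ hτ => by
        nlinarith [hs_mono τ hτ.1, mul_le_mul_of_nonneg_left (hr_mono τ hτ.1) (sq_nonneg N),
          mul_nonneg (he τ hτ.1) (h.r_nonneg τ hτ.1)]
    simp only [h.K_zero] at this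
    linarith
  have hrt : ∀ t, 0 ≤ t → Q₀ * t ^ 2 ≤ r t := fun t ht => by
    have := le_of_hasDerivAt_nonneg ht (f := fun τ => r τ - Q₀ * τ ^ 2)
      (fun τ hτ => (h.hasDerivAt_r τ hτ.1).sub ((hasDerivAt_pow 2 τ).const_mul Q₀))
      fun τ hτ => by
        have := hKt τ hτ.1
        simp only [Nat.cast_ofNat, Nat.add_one_sub_one, pow_one]
        linarith
    have h0 := h.r_nonneg 0 le_rfl
    norm_num at this
    linarith
  have hlow : ∀ t, 0 ≤ t → 2 * N * e t * (Q₀ * t ^ 2) ≤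
      2 * e t * (K t + N * r t) + 2 * d t * J t := fun t ht => by
    have := mul_le_mul_of_nonneg_left (hrt t ht) (mul_nonneg hN.le (he t ht))
    nlinarith [hdJ t ht]
  have h01 := le_of_hasDerivAt_nonneg zero_le_one
    (f := fun t => (s t + 2 * N * K t + N ^ 2 * r t) * Real.exp (-(2 * N * t)) -
      2 / 3 * N * e₀ * Real.exp (-(2 * N)) * Q₀ * t ^ 3)
    (fun τ hτ => (h.hasDerivAt_energy hτ.1).sub ((hasDerivAt_pow 3 τ).const_mul _))
    fun τ hτ => by
      have hexp : Real.exp (-(2 * N)) ≤ Real.exp (-(2 * N * τ)) :=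
        Real.exp_le_exp.2 (by nlinarith [hτ.2])
      have h1 := hlow τ hτ.1
      have h2 : 2 * N * e₀ * (Q₀ * τ ^ 2) * Real.exp (-(2 * N)) ≤
          (2 * e τ * (K τ + N * r τ) + 2 * d τ * J τ) * Real.exp (-(2 * N * τ)) := by
        have h3 : 2 * N * e₀ * (Q₀ * τ ^ 2) ≤ 2 * N * e τ * (Q₀ * τ ^ 2) := by
          gcongr
          exact he1 τ hτ
        exact mul_le_mul (h3.trans h1) hexp (Real.exp_pos _).le
          ((by positivity : 0 ≤ 2 * N * e₀ * (Q₀ * τ ^ 2)).trans (h3.trans h1))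
      simp only [Nat.cast_ofNat, Nat.add_one_sub_one]
      linarith
  have h1t := le_of_hasDerivAt_nonneg ht
    (f := fun t => (s t + 2 * N * K t + N ^ 2 * r t) * Real.exp (-(2 * N * t)))
    (fun τ hτ => h.hasDerivAt_energy (zero_le_one.trans hτ.1))
    fun τ hτ => by
      have h0 : 0 ≤ τ := zero_le_one.trans hτ.1
      have := he τ h0
      exact mul_nonneg ((by positivity : 0 ≤ 2 * N * e τ * (Q₀ * τ ^ 2)).trans (hlow τ h0))
        (Real.exp_pos _).le
  simp only [h.K_zero, mul_zero, neg_zero, Real.exp_zero, mul_one, add_zero] at h01 h1t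
  norm_num at h01
  rw [hQ₀] at h01 ⊢
  linarith

lemma IsAmplitude.energy_eq (h : IsAmplitude N e d r s K J) (he : ∀ t, e t = 0)
    (hd : ∀ t, d t = 0) {t : ℝ} (ht : 0 ≤ t) :
    (s t + 2 * N * K t + N ^ 2 * r t) * Real.exp (-(2 * N * t)) = s 0 + N ^ 2 * r 0 := by
  have h1 := le_of_hasDerivAt_nonneg ht (fun τ hτ => h.hasDerivAt_energy hτ.1)
    fun τ _ => by simp [he, hd]
  have h2 := le_of_hasDerivAt_nonneg ht (fun τ hτ => (h.hasDerivAt_energy hτ.1).neg)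
    fun τ _ => by simp [he, hd]
  simp only [h.K_zero, mul_zero, neg_zero, Real.exp_zero, mul_one, add_zero,
    Pi.neg_apply] at h1 h2
  linarith

end Amplification

section Line

open Filter Topology Polynomial ComplexConjugate

lemma isAmplitude_of_hasDerivAt {N : ℝ} {e d W : ℝ → ℝ} {F H μ : ℝ → ℂ}
    (hW0 : ∀ t, 0 ≤ W t) (hW : ∀ t, HasDerivAt W (2 * (μ t).re * W t) t)
    (hF : ∀ t, HasDerivAt F (H t - μ t * F t) t)
    (hH : ∀ t, HasDerivAt H ((((N ^ 2 + e t : ℝ) : ℂ) + d t * Complex.I) * F t - μ t * H t) t)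
    (h0 : (conj (F 0) * H 0).re = 0) :
    IsAmplitude N e d (fun t => W t * Complex.normSq (F t)) (fun t => W t * Complex.normSq (H t))
      (fun t => W t * (conj (F t) * H t).re) (fun t => W t * (conj (F t) * H t).im) := by
  have hre : ∀ {G : ℝ → ℂ} {G' : ℂ} {t : ℝ}, HasDerivAt G G' t →
      HasDerivAt (fun t => (G t).re) G'.re t := fun h =>
    Complex.reCLM.hasFDerivAt.comp_hasDerivAt _ h
  have him : ∀ {G : ℝ → ℂ} {G' : ℂ} {t : ℝ}, HasDerivAt G G' t →
      HasDerivAt (fun t => (G t).im) G'.im t := fun h =>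
    Complex.imCLM.hasFDerivAt.comp_hasDerivAt _ h
  constructor
  · exact fun t _ => mul_nonneg (hW0 t) (Complex.normSq_nonneg _)
  · exact fun t _ => mul_nonneg (hW0 t) (Complex.normSq_nonneg _)
  · intro t _
    simp only [Complex.normSq_apply, Complex.mul_re, Complex.mul_im, Complex.conj_re,
      Complex.conj_im]
    ring
  · intro t _
    simp only [Complex.normSq_apply]
    refine ((hW t).mul (((hre (hF t)).mul (hre (hF t))).add
      ((him (hF t)).mul (him (hF t))))).congr_deriv ?_
    simp only [Complex.mul_re, Complex.mul_im, Complex.sub_re, Complex.sub_im, Complex.conj_re,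
      Complex.conj_im, Pi.add_apply, Pi.mul_apply]
    ring
  · intro t _
    simp only [Complex.normSq_apply]
    refine ((hW t).mul (((hre (hH t)).mul (hre (hH t))).add
      ((him (hH t)).mul (him (hH t))))).congr_deriv ?_
    simp only [Complex.mul_re, Complex.mul_im, Complex.sub_re, Complex.sub_im, Complex.conj_re,
      Complex.conj_im, Complex.add_re, Complex.add_im, Complex.ofReal_re, Complex.ofReal_im,
      Complex.I_re, Complex.I_im, Pi.add_apply, Pi.mul_apply]
    ring
  · intro t _
    simp only [Complex.normSq_apply, Complex.mul_re, Complex.conj_re, Complex.conj_im, neg_mul,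
      sub_neg_eq_add]
    refine ((hW t).mul (((hre (hF t)).mul (hre (hH t))).add
      ((him (hF t)).mul (him (hH t))))).congr_deriv ?_
    simp only [Complex.mul_re, Complex.mul_im, Complex.sub_re, Complex.sub_im,
      Complex.add_re, Complex.add_im, Complex.ofReal_re, Complex.ofReal_im,
      Complex.I_re, Complex.I_im, Pi.add_apply, Pi.mul_apply]
    ring
  · intro t _
    simp only [Complex.normSq_apply, Complex.mul_im, Complex.conj_re, Complex.conj_im, neg_mul,
      ← sub_eq_add_neg]
    refine ((hW t).mul (((hre (hF t)).mul (him (hH t))).sub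
      ((him (hF t)).mul (hre (hH t))))).congr_deriv ?_
    simp only [Complex.mul_re, Complex.mul_im, Complex.sub_re, Complex.sub_im,
      Complex.add_re, Complex.add_im, Complex.ofReal_re, Complex.ofReal_im,
      Complex.I_re, Complex.I_im, Pi.sub_apply, Pi.mul_apply]
    ring
  · simp [h0]

lemma tendsto_exp_neg_mul_cosh :
    Tendsto (fun t => Real.exp (-t) * Real.cosh t) atTop (𝓝 (1 / 2)) := by
  have h : Tendsto (fun t : ℝ => (1 + Real.exp (-t) * Real.exp (-t)) / 2) atTop (𝓝 (1 / 2)) := by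
    have := Real.tendsto_exp_neg_atTop_nhds_zero
    simpa using ((this.mul this).const_add 1).div_const 2
  refine h.congr fun t => ?_
  rw [Real.cosh_eq, mul_div_assoc', mul_add, ← Real.exp_add]
  simp [← Real.exp_add]

lemma tendsto_exp_neg_mul_sinh :
    Tendsto (fun t => Real.exp (-t) * Real.sinh t) atTop (𝓝 (1 / 2)) := by
  have h : Tendsto (fun t : ℝ => (1 - Real.exp (-t) * Real.exp (-t)) / 2) atTop (𝓝 (1 / 2)) := by
    have := Real.tendsto_exp_neg_atTop_nhds_zero
    simpa using ((this.mul this).const_sub 1).div_const 2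
  refine h.congr fun t => ?_
  rw [Real.sinh_eq, mul_div_assoc', mul_sub, ← Real.exp_add]
  simp [← Real.exp_add]

lemma tendsto_exp_neg_pow_mul_eval {X : ℝ → ℂ} {κ : ℂ}
    (hX : Tendsto (fun t : ℝ => (Real.exp (-t) : ℂ) * X t) atTop (𝓝 κ)) (p : ℂ[X]) {n : ℕ}
    (hp : p.natDegree ≤ n) :
    Tendsto (fun t : ℝ => (Real.exp (-t) : ℂ) ^ n * p.eval (X t)) atTop
      (𝓝 (p.coeff n * κ ^ n)) := by
  have h0 : Tendsto (fun t : ℝ => (Real.exp (-t) : ℂ)) atTop (𝓝 0) := by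
    exact_mod_cast (Complex.continuous_ofReal.tendsto 0).comp Real.tendsto_exp_neg_atTop_nhds_zero
  have hsum : ∀ t : ℝ, (Real.exp (-t) : ℂ) ^ n * p.eval (X t) = ∑ i ∈ Finset.range (n + 1),
      p.coeff i * (((Real.exp (-t) : ℂ) * X t) ^ i * (Real.exp (-t) : ℂ) ^ (n - i)) := by
    intro t
    rw [eval_eq_sum_range' (Nat.lt_succ_of_le hp), Finset.mul_sum]
    refine Finset.sum_congr rfl fun i hi => ?_
    rw [mul_pow]
    have := pow_mul_pow_sub (Real.exp (-t) : ℂ) (Nat.le_of_lt_succ (Finset.mem_range.1 hi))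
    rw [← this]
    ring
  simp only [hsum]
  have hval : p.coeff n * κ ^ n =
      ∑ i ∈ Finset.range (n + 1), p.coeff i * (κ ^ i * (0 : ℂ) ^ (n - i)) := by
    rw [Finset.sum_range_succ, Finset.sum_eq_zero]
    · simp
    · intro i hi
      have := Finset.mem_range.1 hi
      rw [zero_pow (by omega)]
      simp
  rw [hval]
  exact tendsto_finsetSum _ fun i _ => ((hX.pow i).mul (h0.pow _)).const_mul _

lemma inv_add_mul_I {x y D : ℝ} (hD : x ^ 2 + y ^ 2 = D) :
    ((x : ℂ) + y * Complex.I)⁻¹ = (x / D : ℝ) - (y / D : ℝ) * Complex.I := by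
  subst hD
  apply Complex.ext <;>
    simp [Complex.inv_re, Complex.inv_im, Complex.normSq_apply, pow_two, neg_div,
      -Complex.ofReal_div]

/-- The amplitude of `(sin (z/2)) ^ a (cos (z/2)) ^ b P (cos z)` along a vertical line `z = θ + i t`
with `cos θ = c`, `sin θ = s`. -/
theorem exists_isAmplitude {a b c s : ℝ} (hs : 0 < s) (hcs : c ^ 2 + s ^ 2 = 1) {n : ℕ}
    (hn : 1 ≤ n) {P : ℝ[X]} (hPm : P.Monic) (hPn : P.natDegree = n)
    (hode : (1 - X ^ 2) * derivative (derivative P) +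
      (C (b - a) - C (a + b + 1) * X) * derivative P + C (n * (n + a + b)) * P = 0)
    {N : ℝ} (hN : N = n + (a + b) / 2) :
    ∃ r q K J : ℝ → ℝ, IsAmplitude N
      (fun t => a * (1 - a) / 2 * (1 - c * Real.cosh t) / (Real.cosh t - c) ^ 2 +
        b * (1 - b) / 2 * (1 + c * Real.cosh t) / (Real.cosh t + c) ^ 2)
      (fun t => s * Real.sinh t * (b * (1 - b) / 2 / (Real.cosh t + c) ^ 2 -
        a * (1 - a) / 2 / (Real.cosh t - c) ^ 2)) r q K J ∧
      r 0 = (1 - c) ^ a * (1 + c) ^ b * P.eval c ^ 2 ∧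
      q 0 = (1 - c) ^ a * (1 + c) ^ b *
        (-(s * (derivative P).eval c) + ((a + b) * c + (a - b)) / (2 * s) * P.eval c) ^ 2 ∧
      Tendsto (fun t => (q t + 2 * N * K t + N ^ 2 * r t) * Real.exp (-(2 * N * t))) atTop
        (𝓝 (4 * N ^ 2 * ((1 / 2) ^ a * (1 / 2) ^ b * (1 / 4) ^ n))) := by
  have hc1 : c < 1 := by nlinarith
  have hc2 : -1 < c := by nlinarith
  have hC1 : ∀ t, 0 < Real.cosh t - c := fun t => by linarith [Real.one_le_cosh t]
  have hC2 : ∀ t, 0 < Real.cosh t + c := fun t => by linarith [Real.one_le_cosh t]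
  set Z : ℝ → ℂ := fun t => (c * Real.cosh t : ℝ) - (s * Real.sinh t : ℝ) * Complex.I with hZ
  set Y : ℝ → ℂ := fun t => (c * Real.sinh t : ℝ) - (s * Real.cosh t : ℝ) * Complex.I with hY
  set p : ℂ[X] := P.map (algebraMap ℝ ℂ) with hp
  set F : ℝ → ℂ := fun t => p.eval (Z t) with hF
  set μ : ℝ → ℂ := fun t => ((a + b) * Z t + (a - b)) / (2 * Y t) with hμ
  set H : ℝ → ℂ := fun t => Y t * (derivative p).eval (Z t) + μ t * F t with hH
  set W : ℝ → ℝ := fun t => (Real.cosh t - c) ^ a * (Real.cosh t + c) ^ b with hW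
  have hYsq : ∀ t, Y t ^ 2 = Z t ^ 2 - 1 := by
    intro t
    have h1 := Real.cosh_sq t
    apply Complex.ext <;> simp [hY, hZ, pow_two, -Complex.ofReal_cosh, -Complex.ofReal_sinh]
    · nlinarith
    · ring
  have hY0 : ∀ t, Y t ≠ 0 := by
    intro t h
    have := congrArg Complex.im h
    simp [hY, -Complex.ofReal_cosh, -Complex.ofReal_sinh] at this
    rcases this with h | h
    · exact hs.ne' h
    · exact (Real.cosh_pos t).ne' h
  have hZ1 : ∀ t, 1 - Z t ≠ 0 := fun t h => hY0 t (by
    have : Y t ^ 2 = 0 := by rw [hYsq, ← sub_eq_zero.1 h]; ring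
    simpa using this)
  have hZ2 : ∀ t, 1 + Z t ≠ 0 := fun t h => hY0 t (by
    have : Y t ^ 2 = 0 := by rw [hYsq]; linear_combination (Z t - 1) * h
    simpa using this)
  have hodeC : ∀ z : ℂ, (1 - z ^ 2) * (derivative (derivative p)).eval z +
      ((b - a) - (a + b + 1) * z) * (derivative p).eval z + n * (n + a + b) * p.eval z = 0 := by
    intro z
    have := congrArg (fun q : ℝ[X] => (q.map (algebraMap ℝ ℂ)).eval z) hode
    simpa [hp, Polynomial.derivative_map, eval_map_algebraMap] using this
  have dZ : ∀ t, HasDerivAt Z (Y t) t := fun t =>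
    (((Real.hasDerivAt_cosh t).const_mul c).ofReal_comp).sub
      ((((Real.hasDerivAt_sinh t).const_mul s).ofReal_comp).mul_const Complex.I)
  have dY : ∀ t, HasDerivAt Y (Z t) t := fun t =>
    (((Real.hasDerivAt_sinh t).const_mul c).ofReal_comp).sub
      ((((Real.hasDerivAt_cosh t).const_mul s).ofReal_comp).mul_const Complex.I)
  have dpoly : ∀ (q : ℂ[X]) t, HasDerivAt (fun t => q.eval (Z t))
      ((derivative q).eval (Z t) * Y t) t := fun q t => (q.hasDerivAt (Z t)).comp t (dZ t)
  have dF : ∀ t, HasDerivAt F (H t - μ t * F t) t := fun t =>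
    (dpoly p t).congr_deriv (by simp only [hH]; ring)
  have dμ : ∀ t, HasDerivAt μ ((a + b) / 2 - μ t * Z t / Y t) t := by
    intro t
    refine ((((dZ t).const_mul (a + b : ℂ)).add_const (a - b : ℂ)).div
      ((dY t).const_mul 2) (mul_ne_zero two_ne_zero (hY0 t))).congr_deriv ?_
    simp only [hμ]
    have := hY0 t
    field_simp
  have dH : ∀ t, HasDerivAt H
      ((N ^ 2 + a * (1 - a) / 2 / (1 - Z t) + b * (1 - b) / 2 / (1 + Z t)) * F t - μ t * H t)
      t := by
    intro t
    refine (((dY t).mul (dpoly _ t)).add ((dμ t).mul (dF t))).congr_deriv ?_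
    have e1 := hodeC (Z t)
    have e2 := hYsq t
    have e3 : 2 * Y t * μ t = (a + b) * Z t + (a - b) := by
      simp only [hμ]
      have := hY0 t
      field_simp
    have e4 : (N ^ 2 + a * (1 - a) / 2 / (1 - Z t) + b * (1 - b) / 2 / (1 + Z t) : ℂ) =
        (a + b) / 2 - μ t * Z t / Y t + μ t ^ 2 + n * (n + a + b) := by
      have h0 := hY0 t
      have h1 := hZ1 t
      have h2 := hZ2 t
      have e5 : μ t * Z t / Y t = ((a + b) * Z t + (a - b)) * Z t / (2 * (Z t ^ 2 - 1)) := by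
        rw [← e2]; simp only [hμ]; field_simp
      have e6 : μ t ^ 2 = ((a + b) * Z t + (a - b)) ^ 2 / (4 * (Z t ^ 2 - 1)) := by
        rw [← e2]; simp only [hμ]; field_simp; norm_num
      have h3 : Z t ^ 2 - 1 = -((1 - Z t) * (1 + Z t)) := by ring
      rw [e5, e6, hN, h3]
      push_cast
      field_simp
      ring
    rw [e4]
    simp only [hH]
    linear_combination (derivative (derivative p)).eval (Z t) * e2 +
      (derivative p).eval (Z t) * e3 - e1
  have inv1 : ∀ t, (1 - Z t)⁻¹ = ((1 - c * Real.cosh t) / (Real.cosh t - c) ^ 2 : ℝ) -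
      (s * Real.sinh t / (Real.cosh t - c) ^ 2 : ℝ) * Complex.I := by
    intro t
    rw [← inv_add_mul_I]
    · simp only [hZ]; push_cast; ring_nf
    · have := Real.cosh_sq t
      linear_combination -s ^ 2 * this + (Real.cosh t ^ 2 - 1) * hcs
  have inv2 : ∀ t, (1 + Z t)⁻¹ = ((1 + c * Real.cosh t) / (Real.cosh t + c) ^ 2 : ℝ) -
      (-(s * Real.sinh t) / (Real.cosh t + c) ^ 2 : ℝ) * Complex.I := by
    intro t
    rw [← inv_add_mul_I]
    · simp only [hZ]; push_cast; ring_nf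
    · have := Real.cosh_sq t
      linear_combination -s ^ 2 * this + (Real.cosh t ^ 2 - 1) * hcs
  have hφ : ∀ t, (N ^ 2 + a * (1 - a) / 2 / (1 - Z t) + b * (1 - b) / 2 / (1 + Z t) : ℂ) =
      ((N ^ 2 + (a * (1 - a) / 2 * (1 - c * Real.cosh t) / (Real.cosh t - c) ^ 2 +
        b * (1 - b) / 2 * (1 + c * Real.cosh t) / (Real.cosh t + c) ^ 2) : ℝ) : ℂ) +
      ((s * Real.sinh t * (b * (1 - b) / 2 / (Real.cosh t + c) ^ 2 -
        a * (1 - a) / 2 / (Real.cosh t - c) ^ 2) : ℝ) : ℂ) * Complex.I := by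
    intro t
    rw [div_eq_mul_inv _ (1 - Z t), div_eq_mul_inv _ (1 + Z t), inv1, inv2]
    push_cast
    ring
  have dW : ∀ t, HasDerivAt W (2 * (μ t).re * W t) t := by
    intro t
    have h1 : 2 * (μ t).re =
        a * Real.sinh t / (Real.cosh t - c) + b * Real.sinh t / (Real.cosh t + c) := by
      have h2 : 2 * μ t = -(a * (Y t * (1 - Z t)⁻¹)) + b * (Y t * (1 + Z t)⁻¹) := by
        have h0 := hY0 t
        have h1 := hZ1 t
        have h2 := hZ2 t
        have h3 := hYsq t
        simp only [hμ]
        field_simp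
        linear_combination (a * (1 + Z t) - b * (1 - Z t)) * h3
      have h3 := congrArg Complex.re h2
      have h4 : (2 * μ t).re = 2 * (μ t).re := by simp
      rw [h4, inv1, inv2] at h3
      rw [h3]
      have h5 := (hC1 t).ne'
      have h6 := (hC2 t).ne'
      simp only [hY, Complex.add_re, Complex.neg_re, Complex.mul_re, Complex.sub_re,
        Complex.sub_im, Complex.mul_im, Complex.ofReal_re, Complex.ofReal_im, Complex.I_re,
        Complex.I_im, mul_zero, mul_one, zero_mul, sub_zero, zero_sub, add_zero]
      have h7 : c * Real.sinh t * ((1 - c * Real.cosh t) / (Real.cosh t - c) ^ 2) -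
          s * Real.cosh t * (s * Real.sinh t / (Real.cosh t - c) ^ 2) =
          -(Real.sinh t / (Real.cosh t - c)) := by
        field_simp
        linear_combination -(Real.sinh t * Real.cosh t) * hcs
      have h8 : c * Real.sinh t * ((1 + c * Real.cosh t) / (Real.cosh t + c) ^ 2) +
          s * Real.cosh t * (s * Real.sinh t / (Real.cosh t + c) ^ 2) =
          Real.sinh t / (Real.cosh t + c) := by
        field_simp
        linear_combination (Real.sinh t * Real.cosh t) * hcs
      linear_combination -a * h7 + b * h8
    rw [h1]
    refine (((Real.hasDerivAt_cosh t).sub_const c).rpow_const (p := a)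
      (Or.inl (hC1 t).ne')).mul (((Real.hasDerivAt_cosh t).add_const c).rpow_const (p := b)
      (Or.inl (hC2 t).ne')) |>.congr_deriv ?_
    have h5 := (hC1 t).ne'
    have h6 := (hC2 t).ne'
    rw [Real.rpow_sub_one h5, Real.rpow_sub_one h6]
    simp only [hW]
    field_simp
  have hZ0 : Z 0 = (c : ℂ) := by simp [hZ]
  have hY00 : Y 0 = -(s * Complex.I) := by simp [hY]
  have hev : ∀ q : ℝ[X], (q.map (algebraMap ℝ ℂ)).eval (c : ℂ) = (q.eval c : ℝ) := by
    intro q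
    rw [eval_map_algebraMap]
    exact Polynomial.aeval_algebraMap_apply ℂ c q |>.trans (by simp)
  have hF0 : F 0 = (P.eval c : ℝ) := by simp only [hF, hZ0, hp, hev]
  have hH0 : H 0 = ((-(s * (derivative P).eval c) +
      ((a + b) * c + (a - b)) / (2 * s) * P.eval c : ℝ) : ℂ) * Complex.I := by
    have hs' : (s : ℂ) ≠ 0 := by exact_mod_cast hs.ne'
    have hI : ((a + b) * c + (a - b)) / (2 * -(s * Complex.I)) =
        ((a + b) * c + (a - b)) / (2 * s) * Complex.I := by
      field_simp
      rw [Complex.I_sq]; ring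
    simp only [hH, hμ, hF0, hZ0, hY00, hp, Polynomial.derivative_map, hev, hI]
    push_cast
    ring
  have hW0 : W 0 = (1 - c) ^ a * (1 + c) ^ b := by simp [hW]
  refine ⟨_, _, _, _, isAmplitude_of_hasDerivAt (μ := μ) (F := F) (H := H) (W := W)
    (fun t => ?_) dW dF (fun t => ?_) ?_, ?_, ?_, ?_⟩
  · have := hC1 t
    have := hC2 t
    positivity
  · rw [← hφ]
    exact dH t
  · rw [hF0, hH0, Complex.conj_ofReal]
    simp only [Complex.mul_re, Complex.mul_im, Complex.ofReal_re, Complex.ofReal_im,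
      Complex.I_re, Complex.I_im]
    ring
  · simp only [hW0, hF0, Complex.normSq_ofReal]
    ring
  · simp only [hW0, hH0, Complex.normSq_mul, Complex.normSq_ofReal, Complex.normSq_I]
    ring
  have lZ : Tendsto (fun t : ℝ => (Real.exp (-t) : ℂ) * Z t) atTop
      (𝓝 ((c - s * Complex.I) / 2)) := by
    have h1 := (Complex.continuous_ofReal.tendsto _).comp tendsto_exp_neg_mul_cosh
    have h2 := (Complex.continuous_ofReal.tendsto _).comp tendsto_exp_neg_mul_sinh
    have h3 := (h1.const_mul (c : ℂ)).sub (h2.const_mul (s * Complex.I))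
    convert h3 using 2
    · simp only [hZ, Function.comp]; push_cast; ring
    · push_cast; ring
  have lY : Tendsto (fun t : ℝ => (Real.exp (-t) : ℂ) * Y t) atTop
      (𝓝 ((c - s * Complex.I) / 2)) := by
    have h1 := (Complex.continuous_ofReal.tendsto _).comp tendsto_exp_neg_mul_cosh
    have h2 := (Complex.continuous_ofReal.tendsto _).comp tendsto_exp_neg_mul_sinh
    have h3 := (h2.const_mul (c : ℂ)).sub (h1.const_mul (s * Complex.I))
    convert h3 using 2
    · simp only [hY, Function.comp]; push_cast; ring
    · push_cast; ring
  have l0 : Tendsto (fun t : ℝ => (Real.exp (-t) : ℂ)) atTop (𝓝 0) := by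
    exact_mod_cast (Complex.continuous_ofReal.tendsto 0).comp Real.tendsto_exp_neg_atTop_nhds_zero
  set κ : ℂ := (c - s * Complex.I) / 2 with hκ
  have hκn : Complex.normSq κ = 1 / 4 := by
    have : κ = ((c / 2 : ℝ) : ℂ) + ((-(s / 2) : ℝ) : ℂ) * Complex.I := by
      rw [hκ]; push_cast; ring
    rw [this, Complex.normSq_add_mul_I]
    linear_combination hcs / 4
  have hκ0 : κ ≠ 0 := by
    intro h
    rw [h] at hκn
    norm_num at hκn
  have lμ : Tendsto μ atTop (𝓝 ((a + b) / 2)) := by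
    have h1 := ((lZ.const_mul (a + b : ℂ)).add (l0.const_mul (a - b : ℂ))).div
      (lY.const_mul 2) (mul_ne_zero two_ne_zero hκ0)
    have h2 : ((a + b) * κ + (a - b) * 0) / (2 * κ) = ((a : ℂ) + b) / 2 := by
      field_simp; ring
    rw [h2] at h1
    refine h1.congr fun t => ?_
    have h3 : (Real.exp (-t) : ℂ) ≠ 0 := by exact_mod_cast (Real.exp_pos (-t)).ne'
    have h4 := hY0 t
    simp only [hμ, Pi.div_apply]
    field_simp
  have hpn : p.natDegree = n := by rw [hp, Polynomial.natDegree_map, hPn]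
  have hpc : p.coeff n = 1 := by
    rw [hp, Polynomial.coeff_map, ← hPn, hPm.coeff_natDegree, map_one]
  obtain ⟨m, rfl⟩ : ∃ m, n = m + 1 := ⟨n - 1, by omega⟩
  have lF : Tendsto (fun t : ℝ => (Real.exp (-t) : ℂ) ^ (m + 1) * F t) atTop
      (𝓝 (κ ^ (m + 1))) := by
    have := tendsto_exp_neg_pow_mul_eval lZ p hpn.le
    rwa [hpc, one_mul] at this
  have lG : Tendsto (fun t : ℝ => (Real.exp (-t) : ℂ) ^ m * (derivative p).eval (Z t)) atTop
      (𝓝 ((m + 1) * κ ^ m)) := by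
    have := tendsto_exp_neg_pow_mul_eval lZ (derivative p) (n := m)
      ((natDegree_derivative_le p).trans (by omega))
    rwa [coeff_derivative, hpc, one_mul] at this
  have lH : Tendsto (fun t : ℝ => (Real.exp (-t) : ℂ) ^ (m + 1) * (H t + N * F t)) atTop
      (𝓝 (2 * N * κ ^ (m + 1))) := by
    have h1 := ((lY.mul lG).add (lμ.mul lF)).add (lF.const_mul (N : ℂ))
    have h2 : κ * ((m + 1) * κ ^ m) + (a + b) / 2 * κ ^ (m + 1) + N * κ ^ (m + 1) =
        2 * N * κ ^ (m + 1) := by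
      rw [hN]; push_cast; ring
    rw [h2] at h1
    refine h1.congr fun t => ?_
    simp only [hH]
    ring
  have lN := (Complex.continuous_normSq.tendsto _).comp lH
  have l1 : Tendsto (fun t : ℝ => Real.exp (-t) * (Real.cosh t - c)) atTop (𝓝 (1 / 2)) := by
    have := tendsto_exp_neg_mul_cosh.sub (Real.tendsto_exp_neg_atTop_nhds_zero.mul_const c)
    simp only [zero_mul, sub_zero] at this
    exact this.congr fun t => by ring
  have l2 : Tendsto (fun t : ℝ => Real.exp (-t) * (Real.cosh t + c)) atTop (𝓝 (1 / 2)) := by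
    have := tendsto_exp_neg_mul_cosh.add (Real.tendsto_exp_neg_atTop_nhds_zero.mul_const c)
    simp only [zero_mul, add_zero] at this
    exact this.congr fun t => by ring
  have l3 := ((l1.rpow_const (p := a) (Or.inl (by norm_num))).mul
    (l2.rpow_const (p := b) (Or.inl (by norm_num)))).mul lN
  have hval : (1 / 2 : ℝ) ^ a * (1 / 2) ^ b * Complex.normSq (2 * N * κ ^ (m + 1)) =
      4 * N ^ 2 * ((1 / 2) ^ a * (1 / 2) ^ b * (1 / 4) ^ (m + 1)) := by
    rw [Complex.normSq_mul, Complex.normSq_mul, map_pow, hκn, Complex.normSq_ofReal]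
    have : Complex.normSq 2 = 4 := by
      rw [← Complex.ofReal_ofNat, Complex.normSq_ofReal]; norm_num
    rw [this]; ring
  rw [hval] at l3
  refine l3.congr fun t => ?_
  rw [Real.mul_rpow (Real.exp_pos _).le (hC1 t).le, Real.mul_rpow (Real.exp_pos _).le (hC2 t).le,
    ← Real.exp_mul, ← Real.exp_mul, Function.comp, Complex.normSq_mul, map_pow,
    Complex.normSq_ofReal]
  have hexp : Real.exp (-(2 * N * t)) = Real.exp (-t * a) * Real.exp (-t * b) *
      (Real.exp (-t) * Real.exp (-t)) ^ (m + 1) := by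
    rw [← Real.exp_add, ← Real.exp_add, ← Real.exp_nat_mul, ← Real.exp_add, hN]
    congr 1
    push_cast
    ring
  have hns : Complex.normSq (H t + N * F t) = Complex.normSq (H t) +
      2 * N * (conj (F t) * H t).re + N ^ 2 * Complex.normSq (F t) := by
    simp only [Complex.normSq_apply, Complex.add_re, Complex.add_im, Complex.mul_re,
      Complex.mul_im, Complex.ofReal_re, Complex.ofReal_im, Complex.conj_re, Complex.conj_im]
    ring
  rw [hexp, hns]
  simp only [hW]
  ring

end Line

section Circle

open Polynomial

/-- The amplitude of a weighted polynomial in the variable `x = cos θ`. -/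
noncomputable def circleValue (a b : ℝ) (P : ℝ[X]) (θ : ℝ) : ℝ :=
  (1 - Real.cos θ) ^ (a / 2) * (1 + Real.cos θ) ^ (b / 2) * P.eval (Real.cos θ)

/-- The derivative of `circleValue` with respect to the angle. -/
noncomputable def circleSlope (a b : ℝ) (P : ℝ[X]) (θ : ℝ) : ℝ :=
  (1 - Real.cos θ) ^ (a / 2) * (1 + Real.cos θ) ^ (b / 2) *
    (-(Real.sin θ * (derivative P).eval (Real.cos θ)) +
      ((a + b) * Real.cos θ + (a - b)) / (2 * Real.sin θ) * P.eval (Real.cos θ))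

/-- The potential of the Schrödinger equation solved by `circleValue`. -/
noncomputable def circlePotential (a b N θ : ℝ) : ℝ :=
  N ^ 2 + a * (1 - a) / 2 / (1 - Real.cos θ) + b * (1 - b) / 2 / (1 + Real.cos θ)

variable {a b N θ : ℝ} {P : ℝ[X]}

lemma cos_mem_Ioo (hθ : θ ∈ Set.Ioo 0 Real.pi) : Real.cos θ ∈ Set.Ioo (-1) 1 := by
  have h := Real.sin_pos_of_mem_Ioo hθ
  have h1 := Real.sin_sq_add_cos_sq θ
  constructor <;> nlinarith [sq_nonneg (Real.cos θ + 1), sq_nonneg (Real.cos θ - 1)]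

lemma hasDerivAt_circleWeight (hθ : θ ∈ Set.Ioo 0 Real.pi) :
    HasDerivAt (fun t => (1 - Real.cos t) ^ (a / 2) * (1 + Real.cos t) ^ (b / 2))
      ((1 - Real.cos θ) ^ (a / 2) * (1 + Real.cos θ) ^ (b / 2) *
        (((a + b) * Real.cos θ + (a - b)) / (2 * Real.sin θ))) θ := by
  obtain ⟨h1, h2⟩ := cos_mem_Ioo hθ
  have h3 : 1 - Real.cos θ ≠ 0 := by linarith
  have h4 : 1 + Real.cos θ ≠ 0 := by linarith
  have hs := (Real.sin_pos_of_mem_Ioo hθ).ne'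
  have hsc := Real.sin_sq_add_cos_sq θ
  refine ((((Real.hasDerivAt_cos θ).const_sub 1).rpow_const (p := a / 2) (Or.inl h3)).mul
    (((Real.hasDerivAt_cos θ).const_add 1).rpow_const (p := b / 2) (Or.inl h4))).congr_deriv ?_
  rw [Real.rpow_sub_one h3, Real.rpow_sub_one h4]
  have h5 : Real.sin θ / (1 - Real.cos θ) = (1 + Real.cos θ) / Real.sin θ := by
    field_simp
    linarith
  have h6 : Real.sin θ / (1 + Real.cos θ) = (1 - Real.cos θ) / Real.sin θ := by
    field_simp
    linarith
  have h7 : ((a + b) * Real.cos θ + (a - b)) / (2 * Real.sin θ) =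
      a / 2 * (Real.sin θ / (1 - Real.cos θ)) - b / 2 * (Real.sin θ / (1 + Real.cos θ)) := by
    rw [h5, h6]
    field_simp
    ring
  rw [h7]
  ring

lemma hasDerivAt_circleValue (hθ : θ ∈ Set.Ioo 0 Real.pi) :
    HasDerivAt (circleValue a b P) (circleSlope a b P θ) θ := by
  refine ((hasDerivAt_circleWeight hθ).mul
    ((P.hasDerivAt (Real.cos θ)).comp θ (Real.hasDerivAt_cos θ))).congr_deriv ?_
  simp only [circleSlope, Function.comp]
  ring

lemma hasDerivAt_circleSlope {n : ℕ}
    (hode : (1 - X ^ 2) * derivative (derivative P) +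
      (C (b - a) - C (a + b + 1) * X) * derivative P + C (n * (n + a + b)) * P = 0)
    (hN : N = n + (a + b) / 2) (hθ : θ ∈ Set.Ioo 0 Real.pi) :
    HasDerivAt (circleSlope a b P) (-circlePotential a b N θ * circleValue a b P θ) θ := by
  obtain ⟨h1, h2⟩ := cos_mem_Ioo hθ
  have h3 : 1 - Real.cos θ ≠ 0 := by linarith
  have h4 : 1 + Real.cos θ ≠ 0 := by linarith
  have hs := (Real.sin_pos_of_mem_Ioo hθ).ne'
  have hsc := Real.sin_sq_add_cos_sq θ
  have hcos := Real.hasDerivAt_cos θ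
  have hsin := Real.hasDerivAt_sin θ
  have hP0 := (P.hasDerivAt (Real.cos θ)).comp θ hcos
  have hP1 := ((derivative P).hasDerivAt (Real.cos θ)).comp θ hcos
  have hg := (((hcos.const_mul (a + b)).add_const (a - b)).div (hsin.const_mul 2)
    (by positivity : 2 * Real.sin θ ≠ 0))
  have key := (hasDerivAt_circleWeight (a := a) (b := b) hθ).mul
    ((hsin.mul hP1).neg.add (hg.mul hP0))
  refine key.congr_deriv ?_
  have ho := congrArg (eval (Real.cos θ)) hode
  simp only [eval_add, eval_mul, eval_sub, eval_one, eval_pow, eval_X, eval_C, eval_zero] at ho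
  have hφ : circlePotential a b N θ = N ^ 2 + (a * (1 - a) / 2 * (1 + Real.cos θ) +
      b * (1 - b) / 2 * (1 - Real.cos θ)) / Real.sin θ ^ 2 := by
    have h5 : Real.sin θ ^ 2 = (1 - Real.cos θ) * (1 + Real.cos θ) := by linarith
    rw [h5, circlePotential]
    field_simp
    ring
  rw [hφ, hN]
  simp only [circleValue, Function.comp, Pi.add_apply, Pi.mul_apply, Pi.neg_apply, Pi.div_apply]
  generalize (1 - Real.cos θ) ^ (a / 2) * (1 + Real.cos θ) ^ (b / 2) = W
  generalize eval (Real.cos θ) (derivative (derivative P)) = P2 at *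
  generalize eval (Real.cos θ) (derivative P) = P1 at *
  generalize eval (Real.cos θ) P = P0 at *
  generalize Real.sin θ = s at *
  generalize Real.cos θ = c at *
  field_simp
  linear_combination 4 * s ^ 2 * W * ho +
    (4 * s ^ 2 * P2 * W + W * P0 * ((a + b) ^ 2 - 2 * (a + b))) * hsc

lemma sq_le_of_deriv_nonpos {u v φ φ' : ℝ → ℝ} {x y N : ℝ} (hxy : x ≤ y) (hN : 0 < N)
    (hu : ∀ t ∈ Set.Icc x y, HasDerivAt u (v t) t)
    (hv : ∀ t ∈ Set.Icc x y, HasDerivAt v (-φ t * u t) t)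
    (hφ : ∀ t ∈ Set.Icc x y, HasDerivAt φ (φ' t) t)
    (hφN : ∀ t ∈ Set.Icc x y, N ^ 2 ≤ φ t) (hφ' : ∀ t ∈ Set.Icc x y, φ' t ≤ 0) :
    N ^ 2 * u x ^ 2 ≤ v y ^ 2 + N ^ 2 * u y ^ 2 := by
  have hN2 : 0 < N ^ 2 := by positivity
  have hpos : ∀ t ∈ Set.Icc x y, 0 < φ t := fun t ht => hN2.trans_le (hφN t ht)
  have h : u x ^ 2 + v x ^ 2 / φ x ≤ u y ^ 2 + v y ^ 2 / φ y := by
    refine le_of_hasDerivAt_nonneg (f := fun t => u t ^ 2 + v t ^ 2 / φ t)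
      (f' := fun t => -φ' t * (v t / φ t) ^ 2) hxy (fun t ht => ?_) fun t ht =>
        mul_nonneg (neg_nonneg.2 (hφ' t ht)) (sq_nonneg _)
    have h0 := (hpos t ht).ne'
    refine (((hu t ht).pow 2).add (((hv t ht).pow 2).div (hφ t ht) h0)).congr_deriv ?_
    simp only [Nat.cast_ofNat, Nat.add_one_sub_one, pow_one, Pi.pow_apply]
    field_simp
    ring
  have h1 := hpos x (Set.left_mem_Icc.2 hxy)
  have h2 := hφN y (Set.right_mem_Icc.2 hxy)
  have h3 : v y ^ 2 / φ y ≤ v y ^ 2 / N ^ 2 := by gcongr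
  have h4 : 0 ≤ v x ^ 2 / φ x := by positivity
  have h5 : u x ^ 2 ≤ u y ^ 2 + v y ^ 2 / N ^ 2 := by linarith
  calc N ^ 2 * u x ^ 2 ≤ N ^ 2 * (u y ^ 2 + v y ^ 2 / N ^ 2) := by gcongr
    _ = v y ^ 2 + N ^ 2 * u y ^ 2 := by field_simp; ring

lemma sq_le_of_deriv_nonneg {u v φ φ' : ℝ → ℝ} {x y N : ℝ} (hxy : x ≤ y) (hN : 0 < N)
    (hu : ∀ t ∈ Set.Icc x y, HasDerivAt u (v t) t)
    (hv : ∀ t ∈ Set.Icc x y, HasDerivAt v (-φ t * u t) t)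
    (hφ : ∀ t ∈ Set.Icc x y, HasDerivAt φ (φ' t) t)
    (hφN : ∀ t ∈ Set.Icc x y, N ^ 2 ≤ φ t) (hφ' : ∀ t ∈ Set.Icc x y, 0 ≤ φ' t) :
    N ^ 2 * u y ^ 2 ≤ v x ^ 2 + N ^ 2 * u x ^ 2 := by
  have hmem : ∀ t ∈ Set.Icc (-y) (-x), -t ∈ Set.Icc x y := fun t ht =>
    ⟨le_neg.1 ht.2, neg_le.1 ht.1⟩
  have h := sq_le_of_deriv_nonpos (u := fun t => u (-t)) (v := fun t => -v (-t))
    (φ := fun t => φ (-t)) (φ' := fun t => -φ' (-t)) (neg_le_neg hxy) hN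
    (fun t ht => ((hu _ (hmem t ht)).scomp t (hasDerivAt_neg t)).congr_deriv (by simp))
    (fun t ht => ((hv _ (hmem t ht)).scomp t (hasDerivAt_neg t)).neg.congr_deriv (by simp))
    (fun t ht => ((hφ _ (hmem t ht)).scomp t (hasDerivAt_neg t)).congr_deriv (by simp))
    (fun t ht => hφN _ (hmem t ht)) (fun t ht => neg_nonpos.2 (hφ' _ (hmem t ht)))
  simpa using h

lemma hasDerivAt_circlePotential (hθ : θ ∈ Set.Ioo 0 Real.pi) :
    HasDerivAt (circlePotential a b N) (Real.sin θ * (b * (1 - b) / 2 / (1 + Real.cos θ) ^ 2 -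
      a * (1 - a) / 2 / (1 - Real.cos θ) ^ 2)) θ := by
  obtain ⟨h1, h2⟩ := cos_mem_Ioo hθ
  have h3 : 1 - Real.cos θ ≠ 0 := by linarith
  have h4 : 1 + Real.cos θ ≠ 0 := by linarith
  have hcos := Real.hasDerivAt_cos θ
  refine ((((hasDerivAt_const θ (a * (1 - a) / 2)).div (hcos.const_sub 1) h3).const_add
    (N ^ 2)).add ((hasDerivAt_const θ (b * (1 - b) / 2)).div (hcos.const_add 1) h4)).congr_deriv ?_
  field_simp
  ring

lemma le_circlePotential (ha : a ∈ Set.Icc 0 1) (hb : b ∈ Set.Icc 0 1)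
    (hθ : θ ∈ Set.Ioo 0 Real.pi) : N ^ 2 ≤ circlePotential a b N θ := by
  obtain ⟨h1, h2⟩ := cos_mem_Ioo hθ
  have h3 : 0 ≤ a * (1 - a) / 2 / (1 - Real.cos θ) :=
    div_nonneg (div_nonneg (mul_nonneg ha.1 (sub_nonneg.2 ha.2)) zero_le_two) (by linarith)
  have h4 : 0 ≤ b * (1 - b) / 2 / (1 + Real.cos θ) :=
    div_nonneg (div_nonneg (mul_nonneg hb.1 (sub_nonneg.2 hb.2)) zero_le_two) (by linarith)
  unfold circlePotential
  linarith

end Circle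

section Energy

open Polynomial Filter Topology

/-- Real part of the potential on the vertical line through `arccos c`, at `C = cosh t`. -/
noncomputable def lineReal (A B c C : ℝ) : ℝ :=
  A * (1 - c * C) / (C - c) ^ 2 + B * (1 + c * C) / (C + c) ^ 2

/-- Imaginary part of the potential on the vertical line through `arccos c`, up to the factor
`sin (arccos c) * sinh t`. -/
noncomputable def lineImag (A B c C : ℝ) : ℝ :=
  B / (C + c) ^ 2 - A / (C - c) ^ 2

/-- The potential on the vertical line through `arccos c` has an imaginary part of constant sign,
which its real part dominates; the real part is at least `e₀` near the real axis. -/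
structure IsGoodLine (A B c s e₀ : ℝ) : Prop where
  nonneg : 0 ≤ e₀
  sign : (∀ C, 1 ≤ C → 0 ≤ lineImag A B c C) ∨ (∀ C, 1 ≤ C → lineImag A B c C ≤ 0)
  abs_le : ∀ C, 1 ≤ C → s * |lineImag A B c C| ≤ lineReal A B c C
  le_lineReal : ∀ C ∈ Set.Icc 1 (Real.cosh 1), e₀ ≤ lineReal A B c C

variable {a b N θ : ℝ} {n : ℕ} {P : ℝ[X]}

/-- The energy of `circleValue`. -/
noncomputable def circleEnergy (a b N : ℝ) (P : ℝ[X]) (θ : ℝ) : ℝ :=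
  circleSlope a b P θ ^ 2 + N ^ 2 * circleValue a b P θ ^ 2

/-- The Jacobi equation, with the parameters shifted by one half. -/
def IsJacobiSolution (a b : ℝ) (n : ℕ) (P : ℝ[X]) : Prop :=
  P.Monic ∧ P.natDegree = n ∧ (1 - X ^ 2) * derivative (derivative P) +
    (C (b - a) - C (a + b + 1) * X) * derivative P + C (n * (n + a + b)) * P = 0

lemma exists_isAmplitude_circleEnergy (hP : IsJacobiSolution a b n P) (hn : 1 ≤ n)
    (hN : N = n + (a + b) / 2) (hθ : θ ∈ Set.Ioo 0 Real.pi) :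
    ∃ r q K J : ℝ → ℝ, IsAmplitude N
      (fun t => lineReal (a * (1 - a) / 2) (b * (1 - b) / 2) (Real.cos θ) (Real.cosh t))
      (fun t => Real.sin θ * Real.sinh t *
        lineImag (a * (1 - a) / 2) (b * (1 - b) / 2) (Real.cos θ) (Real.cosh t)) r q K J ∧
      q 0 + N ^ 2 * r 0 = circleEnergy a b N P θ ∧
      Tendsto (fun t => (q t + 2 * N * K t + N ^ 2 * r t) * Real.exp (-(2 * N * t))) atTop
        (𝓝 (4 * N ^ 2 * ((1 / 2) ^ a * (1 / 2) ^ b * (1 / 4) ^ n))) := by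
  obtain ⟨r, q, K, J, h, hr, hq, hlim⟩ := exists_isAmplitude (Real.sin_pos_of_mem_Ioo hθ)
    (Real.cos_sq_add_sin_sq θ) hn hP.1 hP.2.1 hP.2.2 hN
  refine ⟨r, q, K, J, h, ?_, hlim⟩
  obtain ⟨h1, h2⟩ := cos_mem_Ioo hθ
  have hsq : ∀ {x p : ℝ}, 0 ≤ x → x ^ p = (x ^ (p / 2)) ^ 2 := fun {x p} hx => by
    rw [← Real.rpow_mul_natCast hx]
    norm_num
  rw [hr, hq, circleEnergy, circleSlope, circleValue,
    hsq (by linarith : (0 : ℝ) ≤ 1 - Real.cos θ), hsq (by linarith : (0 : ℝ) ≤ 1 + Real.cos θ)]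
  ring

lemma circleEnergy_mul_le (hP : IsJacobiSolution a b n P) (hn : 1 ≤ n)
    (hN : N = n + (a + b) / 2) (ha : 0 ≤ a) (hb : 0 ≤ b) (hθ : θ ∈ Set.Ioo 0 Real.pi) {e₀ : ℝ}
    (hl : IsGoodLine (a * (1 - a) / 2) (b * (1 - b) / 2) (Real.cos θ) (Real.sin θ) e₀) :
    circleEnergy a b N P θ * (1 + 2 / 3 * N * e₀ * Real.exp (-(2 * N))) ≤
      4 * N ^ 2 * ((1 / 2) ^ a * (1 / 2) ^ b * (1 / 4) ^ n) := by
  obtain ⟨r, q, K, J, h, h0, hlim⟩ := exists_isAmplitude_circleEnergy hP hn hN hθ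
  have hn' : (1 : ℝ) ≤ n := by exact_mod_cast hn
  have hN1 : 1 ≤ N := by linarith
  have hs := (Real.sin_pos_of_mem_Ioo hθ).le
  have hsinh : ∀ t : ℝ, 0 ≤ t → 0 ≤ Real.sinh t := fun t ht => Real.sinh_nonneg_iff.2 ht
  have hreal : ∀ t, 0 ≤ lineReal (a * (1 - a) / 2) (b * (1 - b) / 2) (Real.cos θ) (Real.cosh t) :=
    fun t => (mul_nonneg hs (abs_nonneg _)).trans (hl.abs_le _ (Real.one_le_cosh t))
  have hde : ∀ t, 0 ≤ t → ∀ x : ℝ,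
      x ≤ |lineImag (a * (1 - a) / 2) (b * (1 - b) / 2) (Real.cos θ) (Real.cosh t)| →
      Real.sin θ * Real.sinh t * x ≤
        lineReal (a * (1 - a) / 2) (b * (1 - b) / 2) (Real.cos θ) (Real.cosh t) *
          Real.sinh (2 * N * t) := by
    intro t ht x hx
    have h1 : Real.sinh t ≤ Real.sinh (2 * N * t) := Real.sinh_le_sinh.2 (by nlinarith)
    have h2 := hl.abs_le _ (Real.one_le_cosh t)
    have h3 := hsinh t ht
    have h4 : Real.sin θ * x ≤ Real.sin θ * _ := mul_le_mul_of_nonneg_left hx hs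
    calc Real.sin θ * Real.sinh t * x = (Real.sin θ * x) * Real.sinh t := by ring
      _ ≤ _ * Real.sinh t := mul_le_mul_of_nonneg_right (h4.trans h2) h3
      _ ≤ _ := mul_le_mul_of_nonneg_left h1 (hreal t)
  have he1 : ∀ t ∈ Set.Icc (0 : ℝ) 1,
      e₀ ≤ lineReal (a * (1 - a) / 2) (b * (1 - b) / 2) (Real.cos θ) (Real.cosh t) :=
    fun t ht => hl.le_lineReal _ ⟨Real.one_le_cosh t, Real.cosh_le_cosh.2 (by
      rw [abs_of_nonneg ht.1, abs_one]; exact ht.2)⟩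
  rw [← h0]
  refine ge_of_tendsto hlim ((eventually_ge_atTop 1).mono fun t ht => ?_)
  rcases hl.sign with hσ | hσ
  · refine h.energy_le (by linarith) (fun t _ => hreal t) (fun t ht => ?_)
      (fun t ht => hde t ht _ (le_abs_self _)) hl.nonneg he1 ht
    exact mul_nonneg (mul_nonneg hs (hsinh t ht)) (hσ _ (Real.one_le_cosh t))
  · refine h.neg.energy_le (by linarith) (fun t _ => hreal t) (fun t ht => ?_)
      (fun t ht => ?_) hl.nonneg he1 ht
    · exact neg_nonneg.2 (mul_nonpos_of_nonneg_of_nonpos (mul_nonneg hs (hsinh t ht))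
        (hσ _ (Real.one_le_cosh t)))
    · rw [← mul_neg]
      exact hde t ht _ (neg_le_abs _)

lemma circleEnergy_eq (hP : IsJacobiSolution a b n P) (hn : 1 ≤ n)
    (hN : N = n + (a + b) / 2) (ha : a * (1 - a) / 2 = 0) (hb : b * (1 - b) / 2 = 0)
    (hθ : θ ∈ Set.Ioo 0 Real.pi) :
    circleEnergy a b N P θ = 4 * N ^ 2 * ((1 / 2) ^ a * (1 / 2) ^ b * (1 / 4) ^ n) := by
  obtain ⟨r, q, K, J, h, h0, hlim⟩ := exists_isAmplitude_circleEnergy hP hn hN hθ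
  rw [← h0]
  refine tendsto_nhds_unique (tendsto_const_nhds.congr' ?_) hlim
  filter_upwards [eventually_ge_atTop 0] with t ht
  exact (h.energy_eq (fun t => by simp [lineReal, ha, hb]) (fun t => by simp [lineImag, ha, hb])
    ht).symm

lemma circleValue_sq_le_of_le (hP : IsJacobiSolution a b n P) (hn : 1 ≤ n)
    (hN : N = n + (a + b) / 2) (ha : a ∈ Set.Icc 0 1) (hb : b ∈ Set.Icc 0 1) {θ₀ : ℝ}
    (hθ : 0 < θ) (hθ₀ : θ₀ < Real.pi) (hle : θ ≤ θ₀)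
    (hφ : ∀ t ∈ Set.Icc θ θ₀, b * (1 - b) / 2 / (1 + Real.cos t) ^ 2 ≤
      a * (1 - a) / 2 / (1 - Real.cos t) ^ 2) :
    N ^ 2 * circleValue a b P θ ^ 2 ≤ circleEnergy a b N P θ₀ := by
  have hn' : (1 : ℝ) ≤ n := by exact_mod_cast hn
  have hN1 : 1 ≤ N := by linarith [ha.1, hb.1]
  have hmem : ∀ t ∈ Set.Icc θ θ₀, t ∈ Set.Ioo 0 Real.pi := fun t ht =>
    ⟨hθ.trans_le ht.1, ht.2.trans_lt hθ₀⟩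
  refine sq_le_of_deriv_nonpos hle (by linarith) (fun t ht => hasDerivAt_circleValue (hmem t ht))
    (fun t ht => hasDerivAt_circleSlope hP.2.2 hN (hmem t ht))
    (fun t ht => hasDerivAt_circlePotential (hmem t ht))
    (fun t ht => le_circlePotential ha hb (hmem t ht)) fun t ht => ?_
  exact mul_nonpos_of_nonneg_of_nonpos (Real.sin_pos_of_mem_Ioo (hmem t ht)).le
    (sub_nonpos.2 (hφ t ht))

lemma circleValue_sq_le_of_ge (hP : IsJacobiSolution a b n P) (hn : 1 ≤ n)
    (hN : N = n + (a + b) / 2) (ha : a ∈ Set.Icc 0 1) (hb : b ∈ Set.Icc 0 1) {θ₀ : ℝ}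
    (hθ₀ : 0 < θ₀) (hθ : θ < Real.pi) (hle : θ₀ ≤ θ)
    (hφ : ∀ t ∈ Set.Icc θ₀ θ, a * (1 - a) / 2 / (1 - Real.cos t) ^ 2 ≤
      b * (1 - b) / 2 / (1 + Real.cos t) ^ 2) :
    N ^ 2 * circleValue a b P θ ^ 2 ≤ circleEnergy a b N P θ₀ := by
  have hn' : (1 : ℝ) ≤ n := by exact_mod_cast hn
  have hN1 : 1 ≤ N := by linarith [ha.1, hb.1]
  have hmem : ∀ t ∈ Set.Icc θ₀ θ, t ∈ Set.Ioo 0 Real.pi := fun t ht =>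
    ⟨hθ₀.trans_le ht.1, ht.2.trans_lt hθ⟩
  refine sq_le_of_deriv_nonneg hle (by linarith) (fun t ht => hasDerivAt_circleValue (hmem t ht))
    (fun t ht => hasDerivAt_circleSlope hP.2.2 hN (hmem t ht))
    (fun t ht => hasDerivAt_circlePotential (hmem t ht))
    (fun t ht => le_circlePotential ha hb (hmem t ht)) fun t ht => ?_
  exact mul_nonneg (Real.sin_pos_of_mem_Ioo (hmem t ht)).le (sub_nonneg.2 (hφ t ht))

lemma isGoodLine_of_left_eq_zero {B c s : ℝ} (hB : 0 ≤ B) (hc : 0 ≤ c) (hs : 0 ≤ s)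
    (hcs : c ^ 2 + s ^ 2 = 1) : IsGoodLine 0 B c s (B / (Real.cosh 1 + 1) ^ 2) := by
  have hc1 : c ≤ 1 := by nlinarith
  have hs1 : s ≤ 1 := by nlinarith
  have hi : ∀ C, 1 ≤ C → 0 ≤ lineImag 0 B c C := fun C hC => by
    simp only [lineImag, zero_div, sub_zero]
    positivity
  refine ⟨by positivity, Or.inl hi, fun C hC => ?_, fun C hC => ?_⟩
  · rw [abs_of_nonneg (hi C hC)]
    have h1 : B * s ≤ B * (1 + c * C) := mul_le_mul_of_nonneg_left (by nlinarith) hB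
    simp only [lineImag, lineReal, zero_div, sub_zero, zero_mul, zero_add]
    rw [mul_div_assoc', mul_comm s]
    gcongr
  · have h0 : 0 ≤ C := by linarith [hC.1]
    have h1 : B * 1 ≤ B * (1 + c * C) := mul_le_mul_of_nonneg_left (by nlinarith) hB
    have h2 : 0 < C + c := by linarith [hC.1]
    simp only [lineReal, zero_div, zero_mul, zero_add]
    rw [mul_one] at h1
    have h3 := hC.2
    gcongr

lemma IsGoodLine.reflect {A B c s e₀ : ℝ} (h : IsGoodLine A B c s e₀) :
    IsGoodLine B A (-c) s e₀ := by
  have h1 : ∀ C, lineReal B A (-c) C = lineReal A B c C := fun C => by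
    simp only [lineReal, neg_mul, sub_neg_eq_add, ← sub_eq_add_neg]
    ring
  have h2 : ∀ C, lineImag B A (-c) C = -lineImag A B c C := fun C => by
    simp only [lineImag, sub_neg_eq_add, ← sub_eq_add_neg]
    ring
  refine ⟨h.nonneg, ?_, fun C hC => ?_, fun C hC => ?_⟩
  · simp only [h2, neg_nonneg, neg_nonpos]
    exact h.sign.symm
  · rw [h1, h2, abs_neg]
    exact h.abs_le C hC
  · rw [h1]
    exact h.le_lineReal C hC

/-- The vertical line through the minimum of the potential on the circle is good. -/
lemma isGoodLine_of_pos {k c s : ℝ} (hk : 0 ≤ k) (hs : 0 < s) (hcs : c ^ 2 + s ^ 2 = 1) :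
    IsGoodLine (k * (1 - c) ^ 2) (k * (1 + c) ^ 2) c s
      (2 * k * (1 - c ^ 2) ^ 2 / (Real.cosh 1 ^ 2) ^ 2) := by
  have hc1 : c < 1 := by nlinarith
  have hc2 : -1 < c := by nlinarith
  have hc3 : c ^ 2 < 1 := by nlinarith
  have hC : ∀ C, 1 ≤ C → 0 < C - c ∧ 0 < C + c ∧ 0 < C ^ 2 - c ^ 2 := fun C hC =>
    ⟨by linarith, by linarith, by nlinarith⟩
  have hI : ∀ C, 1 ≤ C → lineImag (k * (1 - c) ^ 2) (k * (1 + c) ^ 2) c C =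
      c * (4 * k * (C - 1) * (C - c ^ 2) / (C ^ 2 - c ^ 2) ^ 2) := by
    intro C h1
    obtain ⟨h2, h3, h4⟩ := hC C h1
    have h5 : C ^ 2 - c ^ 2 = (C - c) * (C + c) := by ring
    rw [lineImag, h5]
    field_simp
    ring
  have hR : ∀ C, 1 ≤ C → lineReal (k * (1 - c) ^ 2) (k * (1 + c) ^ 2) c C =
      2 * k * ((1 - c ^ 2) ^ 2 + 2 * (1 - c ^ 4) * (C - 1) +
        ((1 + c ^ 2) * (1 - 2 * c ^ 2) + 6 * c ^ 2) * (C - 1) ^ 2 + 2 * c ^ 2 * (C - 1) ^ 3) /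
        (C ^ 2 - c ^ 2) ^ 2 := by
    intro C h1
    obtain ⟨h2, h3, h4⟩ := hC C h1
    have h5 : C ^ 2 - c ^ 2 = (C - c) * (C + c) := by ring
    rw [lineReal, h5]
    field_simp
    ring
  have hnn : ∀ C, 1 ≤ C → 0 ≤ 4 * k * (C - 1) * (C - c ^ 2) / (C ^ 2 - c ^ 2) ^ 2 := by
    intro C h1
    have h2 : 0 ≤ C - 1 := by linarith
    have h3 : 0 ≤ C - c ^ 2 := by linarith
    positivity
  have hM : ∀ y : ℝ, 0 ≤ y → (1 - c ^ 2) ^ 2 + (1 - c ^ 2) * y + y ^ 2 ≤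
      (1 - c ^ 2) ^ 2 + 2 * (1 - c ^ 4) * y +
        ((1 + c ^ 2) * (1 - 2 * c ^ 2) + 6 * c ^ 2) * y ^ 2 + 2 * c ^ 2 * y ^ 3 := by
    intro y hy
    have h1 : 0 ≤ (1 - c ^ 2) * (1 + 2 * c ^ 2) * y :=
      mul_nonneg (mul_nonneg (by linarith) (by positivity)) hy
    have h2 : 0 ≤ c ^ 2 * (5 - 2 * c ^ 2) * y ^ 2 :=
      mul_nonneg (mul_nonneg (by positivity) (by linarith)) (by positivity)
    have h3 : 0 ≤ 2 * c ^ 2 * y ^ 3 := by positivity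
    linear_combination h1 + h2 + h3
  refine ⟨by positivity, ?_, fun C h1 => ?_, fun C h1 => ?_⟩
  · rcases le_total 0 c with h | h
    · exact Or.inl fun C h1 => by rw [hI C h1]; exact mul_nonneg h (hnn C h1)
    · exact Or.inr fun C h1 => by
        rw [hI C h1]; exact mul_nonpos_of_nonpos_of_nonneg h (hnn C h1)
  · have h2 : s * |c| ≤ 1 / 2 := by nlinarith [sq_nonneg (s - |c|), sq_abs c]
    have h3 : 0 ≤ C - 1 := by linarith
    rw [hI C h1, hR C h1, abs_mul, abs_of_nonneg (hnn C h1), ← mul_assoc]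
    refine (mul_le_mul_of_nonneg_right h2 (hnn C h1)).trans ?_
    rw [mul_div_assoc']
    refine div_le_div_of_nonneg_right ?_ (by positivity)
    have h4 := mul_le_mul_of_nonneg_left (hM (C - 1) h3) (by linarith : 0 ≤ 2 * k)
    have h5 : 0 ≤ 2 * k * (1 - c ^ 2) ^ 2 := by positivity
    linear_combination h4 + h5
  · have h3 : 0 ≤ C - 1 := by linarith [h1.1]
    rw [hR C h1.1]
    have h4 := hM (C - 1) h3
    have h5 : 0 ≤ (1 - c ^ 2) * (C - 1) := mul_nonneg (by linarith) h3
    have h6 : C ^ 2 - c ^ 2 ≤ Real.cosh 1 ^ 2 := by nlinarith [h1.2, h1.1, sq_nonneg c]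
    have h7 := (hC C h1.1).2.2
    have h8 := h4.trans' (by nlinarith [sq_nonneg (C - 1)] : (1 - c ^ 2) ^ 2 ≤ _)
    have h9 := (sq_nonneg (1 - c ^ 2)).trans h8
    gcongr

end Energy

section Bounds

open Polynomial

variable {a b θ : ℝ} {n : ℕ} {P : ℝ[X]}

lemma circleEnergy_le_of_isGoodLine (hP : IsJacobiSolution a b n P) (hn : 1 ≤ n) (ha : 0 ≤ a)
    (hb : 0 ≤ b) {e₀ : ℝ} (he₀ : 0 < e₀) : ∃ M < 4 * ((1 / 2) ^ a * (1 / 2) ^ b * (1 / 4) ^ n),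
    ∀ φ ∈ Set.Ioo 0 Real.pi,
      IsGoodLine (a * (1 - a) / 2) (b * (1 - b) / 2) (Real.cos φ) (Real.sin φ) e₀ →
        circleEnergy a b (n + (a + b) / 2) P φ ≤ (n + (a + b) / 2) ^ 2 * M := by
  have hn' : (1 : ℝ) ≤ n := by exact_mod_cast hn
  have hN : 0 < (n : ℝ) + (a + b) / 2 := by linarith
  have hΓ : (0 : ℝ) < (1 / 2) ^ a * (1 / 2) ^ b * (1 / 4) ^ n := by positivity
  have hδ : 0 < 2 / 3 * ((n : ℝ) + (a + b) / 2) * e₀ *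
    Real.exp (-(2 * ((n : ℝ) + (a + b) / 2))) := by positivity
  refine ⟨_, div_lt_self (by positivity) (lt_add_of_pos_right 1 hδ), fun φ hφ hl => ?_⟩
  have h := circleEnergy_mul_le hP hn rfl ha hb hφ hl
  rw [mul_div_assoc', le_div_iff₀ (by positivity)]
  linear_combination h

lemma exists_circleValue_sq_le_of_left_eq_zero (hP : IsJacobiSolution a b n P) (hn : 1 ≤ n)
    (ha : a ∈ Set.Icc 0 1) (hb : b ∈ Set.Icc 0 1) (hA : a * (1 - a) / 2 = 0)
    (hB : 0 < b * (1 - b) / 2) : ∃ M < 4 * ((1 / 2) ^ a * (1 / 2) ^ b * (1 / 4) ^ n),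
    ∀ θ ∈ Set.Ioo 0 Real.pi, circleValue a b P θ ^ 2 ≤ M := by
  obtain ⟨M, hM, h⟩ := circleEnergy_le_of_isGoodLine hP hn ha.1 hb.1
    (e₀ := b * (1 - b) / 2 / (Real.cosh 1 + 1) ^ 2) (by positivity)
  have hN : 0 < ((n : ℝ) + (a + b) / 2) ^ 2 := by
    have hn' : (1 : ℝ) ≤ n := by exact_mod_cast hn
    have := ha.1
    have := hb.1
    positivity
  have hmono : ∀ t, b * (1 - b) / 2 / (1 + Real.cos t) ^ 2 ≥
      a * (1 - a) / 2 / (1 - Real.cos t) ^ 2 := fun t => by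
    rw [hA, zero_div]
    positivity
  have hline : ∀ φ ∈ Set.Ioc 0 (Real.pi / 2), circleEnergy a b (n + (a + b) / 2) P φ ≤
      (n + (a + b) / 2) ^ 2 * M := fun φ hφ => by
    have hmem : φ ∈ Set.Ioo 0 Real.pi := ⟨hφ.1, by linarith [hφ.2, Real.pi_pos]⟩
    refine h φ hmem ?_
    rw [hA]
    exact isGoodLine_of_left_eq_zero hB.le
      (Real.cos_nonneg_of_neg_pi_div_two_le_of_le (by linarith [hφ.1, Real.pi_pos]) hφ.2)
      (Real.sin_pos_of_mem_Ioo hmem).le (Real.cos_sq_add_sin_sq φ)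
  refine ⟨M, hM, fun θ hθ => le_of_mul_le_mul_left ?_ hN⟩
  rcases le_total θ (Real.pi / 2) with hle | hle
  · exact (circleValue_sq_le_of_ge hP hn rfl ha hb hθ.1 hθ.2 le_rfl fun t _ => hmono t).trans
      (hline θ ⟨hθ.1, hle⟩)
  · exact (circleValue_sq_le_of_ge hP hn rfl ha hb (by linarith [Real.pi_pos]) hθ.2 hle
      fun t _ => hmono t).trans (hline _ ⟨by linarith [Real.pi_pos], le_rfl⟩)

lemma exists_circleValue_sq_le_of_right_eq_zero (hP : IsJacobiSolution a b n P) (hn : 1 ≤ n)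
    (ha : a ∈ Set.Icc 0 1) (hb : b ∈ Set.Icc 0 1) (hA : 0 < a * (1 - a) / 2)
    (hB : b * (1 - b) / 2 = 0) : ∃ M < 4 * ((1 / 2) ^ a * (1 / 2) ^ b * (1 / 4) ^ n),
    ∀ θ ∈ Set.Ioo 0 Real.pi, circleValue a b P θ ^ 2 ≤ M := by
  obtain ⟨M, hM, h⟩ := circleEnergy_le_of_isGoodLine hP hn ha.1 hb.1
    (e₀ := a * (1 - a) / 2 / (Real.cosh 1 + 1) ^ 2) (by positivity)
  have hN : 0 < ((n : ℝ) + (a + b) / 2) ^ 2 := by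
    have hn' : (1 : ℝ) ≤ n := by exact_mod_cast hn
    have := ha.1
    have := hb.1
    positivity
  have hmono : ∀ t, b * (1 - b) / 2 / (1 + Real.cos t) ^ 2 ≤
      a * (1 - a) / 2 / (1 - Real.cos t) ^ 2 := fun t => by
    rw [hB, zero_div]
    positivity
  have hline : ∀ φ ∈ Set.Ico (Real.pi / 2) Real.pi, circleEnergy a b (n + (a + b) / 2) P φ ≤
      (n + (a + b) / 2) ^ 2 * M := fun φ hφ => by
    have hmem : φ ∈ Set.Ioo 0 Real.pi := ⟨by linarith [hφ.1, Real.pi_pos], hφ.2⟩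
    refine h φ hmem ?_
    have hc : 0 ≤ -Real.cos φ := neg_nonneg.2
      (Real.cos_nonpos_of_pi_div_two_le_of_le hφ.1 (by linarith [hφ.2, Real.pi_pos]))
    have hl := (isGoodLine_of_left_eq_zero hA.le hc (Real.sin_pos_of_mem_Ioo hmem).le
      (by rw [neg_sq]; exact Real.cos_sq_add_sin_sq φ)).reflect
    rwa [neg_neg, ← hB] at hl
  refine ⟨M, hM, fun θ hθ => le_of_mul_le_mul_left ?_ hN⟩
  rcases le_total (Real.pi / 2) θ with hle | hle
  · exact (circleValue_sq_le_of_le hP hn rfl ha hb hθ.1 hθ.2 le_rfl fun t _ => hmono t).trans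
      (hline θ ⟨hle, hθ.2⟩)
  · exact (circleValue_sq_le_of_le hP hn rfl ha hb hθ.1 (by linarith [Real.pi_pos]) hle
      fun t _ => hmono t).trans (hline _ ⟨le_rfl, by linarith [Real.pi_pos]⟩)

lemma exists_circleValue_sq_le_of_pos (hP : IsJacobiSolution a b n P) (hn : 1 ≤ n)
    (ha : a ∈ Set.Icc 0 1) (hb : b ∈ Set.Icc 0 1) (hA : 0 < a * (1 - a) / 2)
    (hB : 0 < b * (1 - b) / 2) : ∃ M < 4 * ((1 / 2) ^ a * (1 / 2) ^ b * (1 / 4) ^ n),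
    ∀ θ ∈ Set.Ioo 0 Real.pi, circleValue a b P θ ^ 2 ≤ M := by
  have hN : 0 < ((n : ℝ) + (a + b) / 2) ^ 2 := by
    have hn' : (1 : ℝ) ≤ n := by exact_mod_cast hn
    have := ha.1
    have := hb.1
    positivity
  obtain ⟨k, c, hk, hc1, hc2, hAk, hBk⟩ : ∃ k c : ℝ, 0 < k ∧ -1 < c ∧ c < 1 ∧
      a * (1 - a) / 2 = k * (1 - c) ^ 2 ∧ b * (1 - b) / 2 = k * (1 + c) ^ 2 := by
    generalize a * (1 - a) / 2 = A at *
    generalize b * (1 - b) / 2 = B at *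
    have h1 := Real.sqrt_pos.2 hA
    have h2 := Real.sqrt_pos.2 hB
    have h3 : √A ^ 2 = A := Real.sq_sqrt hA.le
    have h4 : √B ^ 2 = B := Real.sq_sqrt hB.le
    refine ⟨(√A + √B) ^ 2 / 4, (√B - √A) / (√A + √B), by positivity, ?_, ?_, ?_, ?_⟩
    · rw [lt_div_iff₀ (by positivity)]
      linarith
    · rw [div_lt_one (by positivity)]
      linarith
    · rw [one_sub_div (by positivity)]
      field_simp
      linear_combination -4 * h3
    · rw [one_add_div (by positivity)]
      field_simp
      linear_combination -4 * h4
  have hφ : Real.arccos c ∈ Set.Ioo 0 Real.pi := ⟨Real.arccos_pos.2 hc2, Real.arccos_lt_pi.2 hc1⟩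
  have hcos := Real.cos_arccos hc1.le hc2.le
  have hsin := Real.sin_pos_of_mem_Ioo hφ
  have hc3 : 0 < 1 - c ^ 2 := by nlinarith
  obtain ⟨M, hM, h⟩ := circleEnergy_le_of_isGoodLine hP hn ha.1 hb.1
    (e₀ := 2 * k * (1 - c ^ 2) ^ 2 / (Real.cosh 1 ^ 2) ^ 2) (by positivity)
  have hline := h _ hφ (by
    rw [hAk, hBk, hcos]
    exact isGoodLine_of_pos hk.le hsin (by
      have := Real.cos_sq_add_sin_sq (Real.arccos c)
      rwa [hcos] at this))
  refine ⟨M, hM, fun θ hθ => le_of_mul_le_mul_left ?_ hN⟩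
  rcases le_total θ (Real.arccos c) with hle | hle
  · refine (circleValue_sq_le_of_le hP hn rfl ha hb hθ.1 hφ.2 hle fun t ht => ?_).trans hline
    have htm : t ∈ Set.Ioo 0 Real.pi := ⟨hθ.1.trans_le ht.1, ht.2.trans_lt hφ.2⟩
    obtain ⟨h1, h2⟩ := cos_mem_Ioo htm
    have h3 : c ≤ Real.cos t := by
      rw [← hcos]
      exact Real.cos_le_cos_of_nonneg_of_le_pi htm.1.le hφ.2.le ht.2
    have h4 : 0 < 1 + Real.cos t := by linarith
    have h5 : 0 < 1 - Real.cos t := by linarith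
    rw [hAk, hBk, mul_div_assoc, mul_div_assoc, ← div_pow, ← div_pow]
    have h6 : 0 ≤ (1 + c) / (1 + Real.cos t) := div_nonneg (by linarith) h4.le
    refine mul_le_mul_of_nonneg_left (pow_le_pow_left₀ h6 ?_ 2) hk.le
    rw [div_le_div_iff₀ h4 h5]
    nlinarith
  · refine (circleValue_sq_le_of_ge hP hn rfl ha hb hφ.1 hθ.2 hle fun t ht => ?_).trans hline
    have htm : t ∈ Set.Ioo 0 Real.pi := ⟨hφ.1.trans_le ht.1, ht.2.trans_lt hθ.2⟩
    obtain ⟨h1, h2⟩ := cos_mem_Ioo htm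
    have h3 : Real.cos t ≤ c := by
      rw [← hcos]
      exact Real.cos_le_cos_of_nonneg_of_le_pi hφ.1.le htm.2.le ht.1
    have h4 : 0 < 1 + Real.cos t := by linarith
    have h5 : 0 < 1 - Real.cos t := by linarith
    rw [hAk, hBk, mul_div_assoc, mul_div_assoc, ← div_pow, ← div_pow]
    have h6 : 0 ≤ (1 - c) / (1 - Real.cos t) := div_nonneg (by linarith) h5.le
    refine mul_le_mul_of_nonneg_left (pow_le_pow_left₀ h6 ?_ 2) hk.le
    rw [div_le_div_iff₀ h5 h4]
    nlinarith

lemma exists_circleValue_sq_le (hP : IsJacobiSolution a b n P) (hn : 1 ≤ n)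
    (ha : a ∈ Set.Icc 0 1) (hb : b ∈ Set.Icc 0 1)
    (hab : ¬(a * (1 - a) / 2 = 0 ∧ b * (1 - b) / 2 = 0)) :
    ∃ M < 4 * ((1 / 2) ^ a * (1 / 2) ^ b * (1 / 4) ^ n),
      ∀ θ ∈ Set.Ioo 0 Real.pi, circleValue a b P θ ^ 2 ≤ M := by
  have hA : 0 ≤ a * (1 - a) / 2 :=
    div_nonneg (mul_nonneg ha.1 (sub_nonneg.2 ha.2)) zero_le_two
  have hB : 0 ≤ b * (1 - b) / 2 :=
    div_nonneg (mul_nonneg hb.1 (sub_nonneg.2 hb.2)) zero_le_two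
  rcases hA.eq_or_lt with hA | hA <;> rcases hB.eq_or_lt with hB | hB
  · exact absurd ⟨hA.symm, hB.symm⟩ hab
  · exact exists_circleValue_sq_le_of_left_eq_zero hP hn ha hb hA.symm hB
  · exact exists_circleValue_sq_le_of_right_eq_zero hP hn ha hb hA hB.symm
  · exact exists_circleValue_sq_le_of_pos hP hn ha hb hA hB

lemma continuous_circleValue (ha : 0 ≤ a) (hb : 0 ≤ b) : Continuous (circleValue a b P) :=
  (((continuous_const.sub Real.continuous_cos).rpow_const fun _ => Or.inr (by positivity)).mul
    ((continuous_const.add Real.continuous_cos).rpow_const fun _ => Or.inr (by positivity))).mul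
    (P.continuous.comp Real.continuous_cos)

lemma circleValue_sq_le_of_forall_mem_Ioo (ha : 0 ≤ a) (hb : 0 ≤ b) {M : ℝ}
    (h : ∀ θ ∈ Set.Ioo 0 Real.pi, circleValue a b P θ ^ 2 ≤ M) :
    ∀ θ ∈ Set.Icc 0 Real.pi, circleValue a b P θ ^ 2 ≤ M := by
  rw [← closure_Ioo Real.pi_pos.ne]
  exact fun θ hθ => le_on_closure h ((continuous_circleValue ha hb).pow 2).continuousOn
    continuousOn_const hθ

/-- Without potential, `circleValue` is a pure cosine wave. -/
lemma exists_circleValue_eq_cos (hP : IsJacobiSolution a b n P) (hn : 1 ≤ n)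
    (ha : 0 ≤ a) (hb : 0 ≤ b) (hA : a * (1 - a) / 2 = 0) (hB : b * (1 - b) / 2 = 0) :
    ∃ R δ : ℝ, R ^ 2 = 4 * ((1 / 2) ^ a * (1 / 2) ^ b * (1 / 4) ^ n) ∧
      δ ∈ Set.Ioc (-Real.pi) Real.pi ∧
      ∀ θ ∈ Set.Icc 0 Real.pi,
        circleValue a b P θ = R * Real.cos ((n + (a + b) / 2) * θ - δ) := by
  have hn' : (1 : ℝ) ≤ n := by exact_mod_cast hn
  obtain ⟨N, hN⟩ : ∃ N : ℝ, N = n + (a + b) / 2 := ⟨_, rfl⟩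
  have hN0 : 0 < N := by linarith
  rw [← hN]
  have hpi : Real.pi / 2 ∈ Set.Ioo 0 Real.pi :=
    ⟨by linarith [Real.pi_pos], by linarith [Real.pi_pos]⟩
  have hu : ∀ t ∈ Set.Ioo 0 Real.pi, HasDerivAt (circleValue a b P) (circleSlope a b P t) t :=
    fun t ht => hasDerivAt_circleValue ht
  have hv : ∀ t ∈ Set.Ioo 0 Real.pi,
      HasDerivAt (circleSlope a b P) (-N ^ 2 * circleValue a b P t) t := fun t ht =>
    (hasDerivAt_circleSlope hP.2.2 hN ht).congr_deriv (by simp [circlePotential, hA, hB])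
  have hconst : ∀ f : ℝ → ℝ, (∀ t ∈ Set.Ioo 0 Real.pi, HasDerivAt f 0 t) →
      ∀ t ∈ Set.Ioo 0 Real.pi, f t = f (Real.pi / 2) := fun f hf t ht =>
    (convex_Ioo 0 Real.pi).is_const_of_fderivWithin_eq_zero (𝕜 := ℝ)
      (fun x hx => (hf x hx).differentiableAt.differentiableWithinAt)
      (fun x hx => by
        have := (hf x hx).hasFDerivAt.hasFDerivWithinAt (s := Set.Ioo 0 Real.pi)
        rw [this.fderivWithin (isOpen_Ioo.uniqueDiffWithinAt hx)]
        ext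
        simp) ht hpi
  have hNt : ∀ t : ℝ, HasDerivAt (fun t => N * t) N t := fun t => by
    simpa using (hasDerivAt_id t).const_mul N
  have hc := hconst (fun t => circleValue a b P t * Real.cos (N * t) -
    circleSlope a b P t * Real.sin (N * t) / N) fun t ht => by
      refine (((hu t ht).mul (hNt t).cos).sub
        (((hv t ht).mul (hNt t).sin).div_const N)).congr_deriv ?_
      field_simp
      ring
  have hs := hconst (fun t => circleValue a b P t * Real.sin (N * t) +
    circleSlope a b P t * Real.cos (N * t) / N) fun t ht => by
      refine (((hu t ht).mul (hNt t).sin).add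
        (((hv t ht).mul (hNt t).cos).div_const N)).congr_deriv ?_
      field_simp
      ring
  have hE := circleEnergy_eq hP hn hN hA hB hpi
  set x := circleValue a b P (Real.pi / 2) * Real.cos (N * (Real.pi / 2)) -
    circleSlope a b P (Real.pi / 2) * Real.sin (N * (Real.pi / 2)) / N with hx
  set y := circleValue a b P (Real.pi / 2) * Real.sin (N * (Real.pi / 2)) +
    circleSlope a b P (Real.pi / 2) * Real.cos (N * (Real.pi / 2)) / N with hy
  have hR : x ^ 2 + y ^ 2 = 4 * ((1 / 2) ^ a * (1 / 2) ^ b * (1 / 4) ^ n) := by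
    have h1 : x ^ 2 + y ^ 2 = circleEnergy a b N P (Real.pi / 2) / N ^ 2 := by
      have h2 := Real.sin_sq_add_cos_sq (N * (Real.pi / 2))
      rw [hx, hy, circleEnergy]
      generalize N * (Real.pi / 2) = w at *
      field_simp
      linear_combination (circleSlope a b P (Real.pi / 2) ^ 2 +
        N ^ 2 * circleValue a b P (Real.pi / 2) ^ 2) * h2
    rw [h1, hE]
    field_simp
  refine ⟨‖(⟨x, y⟩ : ℂ)‖, Complex.arg ⟨x, y⟩, ?_, Complex.arg_mem_Ioc _, ?_⟩
  · rw [← hR, Complex.sq_norm, Complex.normSq_mk]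
    ring
  · have h1 : ‖(⟨x, y⟩ : ℂ)‖ * Real.cos (Complex.arg ⟨x, y⟩) = x := Complex.norm_mul_cos_arg _
    have h2 : ‖(⟨x, y⟩ : ℂ)‖ * Real.sin (Complex.arg ⟨x, y⟩) = y := Complex.norm_mul_sin_arg _
    rw [← closure_Ioo Real.pi_pos.ne]
    refine Set.EqOn.closure (fun t ht => ?_) (continuous_circleValue ha hb) (by fun_prop)
    have h3 := hc t ht
    have h4 := hs t ht
    have h5 := Real.sin_sq_add_cos_sq (N * t)
    simp only [Real.cos_sub]
    linear_combination Real.cos (N * t) * h3 + Real.sin (N * t) * h4 -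
      circleValue a b P t * h5 - Real.cos (N * t) * h1 - Real.sin (N * t) * h2

lemma exists_circleValue_sq_eq (hP : IsJacobiSolution a b n P) (hn : 1 ≤ n)
    (ha : 0 ≤ a) (hb : 0 ≤ b) (hA : a * (1 - a) / 2 = 0) (hB : b * (1 - b) / 2 = 0) :
    (∀ θ ∈ Set.Icc 0 Real.pi,
      circleValue a b P θ ^ 2 ≤ 4 * ((1 / 2) ^ a * (1 / 2) ^ b * (1 / 4) ^ n)) ∧
    ∃ θ ∈ Set.Icc 0 Real.pi,
      circleValue a b P θ ^ 2 = 4 * ((1 / 2) ^ a * (1 / 2) ^ b * (1 / 4) ^ n) := by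
  have hn' : (1 : ℝ) ≤ n := by exact_mod_cast hn
  obtain ⟨R, δ, hR, hδ, h⟩ := exists_circleValue_eq_cos hP hn ha hb hA hB
  have hN1 : 1 ≤ (n : ℝ) + (a + b) / 2 := by linarith
  generalize (n : ℝ) + (a + b) / 2 = N at *
  have hN0 : 0 < N := by linarith
  refine ⟨fun θ hθ => ?_, ?_⟩
  · rw [h θ hθ, mul_pow, ← hR]
    exact mul_le_of_le_one_right (sq_nonneg R) (Real.cos_sq_le_one _)
  · rcases le_total 0 δ with h0 | h0
    · have hmem : δ / N ∈ Set.Icc 0 Real.pi :=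
        ⟨by positivity, (div_le_self h0 hN1).trans hδ.2⟩
      refine ⟨_, hmem, ?_⟩
      rw [h _ hmem, mul_div_cancel₀ _ hN0.ne', sub_self, Real.cos_zero, mul_one, hR]
    · have h1 : 0 ≤ δ + Real.pi := by linarith [hδ.1]
      have hmem : (δ + Real.pi) / N ∈ Set.Icc 0 Real.pi :=
        ⟨by positivity, (div_le_self h1 hN1).trans (by linarith)⟩
      refine ⟨_, hmem, ?_⟩
      rw [h _ hmem, mul_div_cancel₀ _ hN0.ne', add_sub_cancel_left, Real.cos_pi, ← hR]
      ring

end Bounds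

section Supremum

open Polynomial

variable {α β : ℝ} {n : ℕ} {P : ℝ[X]}

lemma IsMonicJacobi.isJacobiSolution (hα : -1 < α) (hβ : -1 < β) (hP : IsMonicJacobi α β n P) :
    IsJacobiSolution (α + 1 / 2) (β + 1 / 2) n P := by
  refine ⟨hP.1, hP.2.1, ?_⟩
  have h := hP.jacobiOp_eq hα hβ
  rw [jacobiOp] at h
  convert h using 5 <;> ring_nf

lemma jacobi_bound_sq (α β : ℝ) (n : ℕ) :
    ((2 : ℝ) ^ (1 - (n : ℝ) - (α / 2 + 1 / 4) - (β / 2 + 1 / 4))) ^ 2 =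
      4 * ((1 / 2) ^ (α + 1 / 2) * (1 / 2) ^ (β + 1 / 2) * (1 / 4) ^ n) := by
  have h4 : (4 : ℝ) = 2 ^ (2 : ℝ) := by norm_num
  have h2 : ∀ x : ℝ, (1 / 2 : ℝ) ^ x = 2 ^ (-x) := fun x => by
    rw [one_div, Real.inv_rpow zero_le_two, Real.rpow_neg zero_le_two]
  have hn : (1 / 4 : ℝ) ^ n = 2 ^ (-(2 * n : ℝ)) := by
    rw [Real.rpow_neg zero_le_two, Real.rpow_mul zero_le_two, ← h4, Real.rpow_natCast, one_div,
      inv_pow]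
  rw [hn, h2, h2, h4, ← Real.rpow_add two_pos, ← Real.rpow_add two_pos, ← Real.rpow_add two_pos,
    ← Real.rpow_mul_natCast zero_le_two]
  congr 1
  push_cast
  ring

lemma abs_circleValue_arccos {x : ℝ} (hx : x ∈ Set.Icc (-1 : ℝ) 1) :
    |circleValue (α + 1 / 2) (β + 1 / 2) P (Real.arccos x)| =
      (1 - x) ^ (α / 2 + 1 / 4) * (1 + x) ^ (β / 2 + 1 / 4) * |P.eval x| := by
  have h1 : 0 ≤ 1 - x := sub_nonneg.2 hx.2
  have h2 : 0 ≤ 1 + x := by linarith [hx.1]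
  rw [circleValue, Real.cos_arccos hx.1 hx.2, abs_mul, abs_of_nonneg (by positivity)]
  ring_nf

lemma jacobiSup_le {M : ℝ} (hM : 0 ≤ M)
    (h : ∀ θ ∈ Set.Icc 0 Real.pi, circleValue (α + 1 / 2) (β + 1 / 2) P θ ^ 2 ≤ M ^ 2) :
    jacobiSup (α / 2 + 1 / 4) (β / 2 + 1 / 4) P ≤ M := by
  refine csSup_le ((Set.nonempty_Icc.2 (by norm_num)).image _) ?_
  rintro _ ⟨x, hx, rfl⟩
  simp only [← abs_circleValue_arccos hx]
  exact abs_le_of_sq_le_sq (h _ ⟨Real.arccos_nonneg x, Real.arccos_le_pi x⟩) hM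

lemma le_jacobiSup {M : ℝ} (hM : 0 ≤ M)
    (h : ∀ θ ∈ Set.Icc 0 Real.pi, circleValue (α + 1 / 2) (β + 1 / 2) P θ ^ 2 ≤ M ^ 2)
    (h' : ∃ θ ∈ Set.Icc 0 Real.pi, circleValue (α + 1 / 2) (β + 1 / 2) P θ ^ 2 = M ^ 2) :
    M ≤ jacobiSup (α / 2 + 1 / 4) (β / 2 + 1 / 4) P := by
  obtain ⟨θ, hθ, hM'⟩ := h'
  have hx : Real.cos θ ∈ Set.Icc (-1) 1 := ⟨Real.neg_one_le_cos θ, Real.cos_le_one θ⟩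
  refine le_csSup ⟨M, ?_⟩ ⟨Real.cos θ, hx, ?_⟩
  · rintro _ ⟨x, hx, rfl⟩
    simp only [← abs_circleValue_arccos hx]
    exact abs_le_of_sq_le_sq (h _ ⟨Real.arccos_nonneg x, Real.arccos_le_pi x⟩) hM
  · simp only [← abs_circleValue_arccos hx]
    rw [Real.arccos_cos hθ.1 hθ.2, ← Real.sqrt_sq_eq_abs, hM', Real.sqrt_sq hM]

end Supremum

theorem jacobi_weighted_sup_le
    (α β : ℝ) (hα : α ∈ Set.Icc (-(1 : ℝ) / 2) (1 / 2))
    (hβ : β ∈ Set.Icc (-(1 : ℝ) / 2) (1 / 2))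
    (P : ℕ → Polynomial ℝ) (hP : ∀ n : ℕ, 1 ≤ n → IsMonicJacobi α β n (P n)) :
    ∀ n : ℕ, 1 ≤ n →
      jacobiSup (α / 2 + 1 / 4) (β / 2 + 1 / 4) (P n) ≤
        (2 : ℝ) ^ (1 - (n : ℝ) - (α / 2 + 1 / 4) - (β / 2 + 1 / 4)) ∧
      (jacobiSup (α / 2 + 1 / 4) (β / 2 + 1 / 4) (P n) =
          (2 : ℝ) ^ (1 - (n : ℝ) - (α / 2 + 1 / 4) - (β / 2 + 1 / 4)) ↔
        (α = -(1 : ℝ) / 2 ∨ α = 1 / 2) ∧ (β = -(1 : ℝ) / 2 ∨ β = 1 / 2)) := by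
  intro n hn
  set a := α + 1 / 2 with ha'
  set b := β + 1 / 2 with hb'
  have ha : a ∈ Set.Icc 0 1 := ⟨by linarith [hα.1], by linarith [hα.2]⟩
  have hb : b ∈ Set.Icc 0 1 := ⟨by linarith [hβ.1], by linarith [hβ.2]⟩
  have hJ : IsJacobiSolution a b n (P n) :=
    (hP n hn).isJacobiSolution (by linarith [hα.1]) (by linarith [hβ.1])
  have hbound := jacobi_bound_sq α β n
  have hpos : (0 : ℝ) < 2 ^ (1 - (n : ℝ) - (α / 2 + 1 / 4) - (β / 2 + 1 / 4)) := by positivity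
  have hiff : ((α = -(1 : ℝ) / 2 ∨ α = 1 / 2) ∧ (β = -(1 : ℝ) / 2 ∨ β = 1 / 2)) ↔
      a * (1 - a) / 2 = 0 ∧ b * (1 - b) / 2 = 0 := by
    have h : ∀ x : ℝ, (x = -(1 : ℝ) / 2 ∨ x = 1 / 2) ↔ (x + 1 / 2) * (1 - (x + 1 / 2)) / 2 = 0 := by
      intro x
      rw [div_eq_zero_iff, mul_eq_zero, or_iff_left (by norm_num : ¬(2 : ℝ) = 0)]
      exact or_congr ⟨fun h => by linarith, fun h => by linarith⟩
        ⟨fun h => by linarith, fun h => by linarith⟩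
    exact and_congr (h α) (h β)
  rw [hiff]
  by_cases hab : a * (1 - a) / 2 = 0 ∧ b * (1 - b) / 2 = 0
  · obtain ⟨hle, heq⟩ := exists_circleValue_sq_eq hJ hn ha.1 hb.1 hab.1 hab.2
    rw [← hbound] at hle heq
    have h := jacobiSup_le hpos.le hle
    exact ⟨h, iff_of_true (h.antisymm (le_jacobiSup hpos.le hle heq)) hab⟩
  · obtain ⟨M, hM, hle⟩ := exists_circleValue_sq_le hJ hn ha hb hab
    rw [← hbound] at hM
    have hle' := circleValue_sq_le_of_forall_mem_Ioo ha.1 hb.1 hle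
    have hM0 : 0 ≤ M := (sq_nonneg _).trans (hle' 0 ⟨le_rfl, Real.pi_pos.le⟩)
    rw [← Real.sq_sqrt hM0] at hle'
    have h := (jacobiSup_le (Real.sqrt_nonneg M) hle').trans_lt ((Real.sqrt_lt' hpos).2 hM)
    exact ⟨h.le, iff_of_false h.ne hab⟩
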